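/- The limit value −λ is uniquely defined: δ V_δ(·) converges uniformly on P(𝕋^d) to the constant −λ as δ → 0⁺ (along the full family, not only along a subsequence). Moreover U(T,·)/T converges uniformly on P(𝕋^d) to −λ as T → +∞. -/

import Mathlib

/- Common framework for "On the long time convergence of potential MFG" (M. Masoero).

We work on the flat torus `𝕋^d`, modeled as `Td d := Fin d → AddCircle 1`.
Smooth functions on the torus are represented by `ℤ^d`-periodic functions on
`Vd d := Fin d → ℝ`; a function on `Vd d` is transported to the torus through the
canonical (measurable) section `secT : Td d → Vd d`.  Probability measures on the
torus are `PTd d := ProbabilityMeasure (Td d)`, endowed with the 1-Wasserstein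
distance `W1` defined through Kantorovich duality.  The Fokker--Planck equations
and their stationary analogues are stated in the sense of distributions, i.e.
against smooth periodic test functions; `σ` is the viscosity parameter
(everywhere `σ = 1` except in the non-convex example). -/

open MeasureTheory Real Set Filter

noncomputable section

abbrev Vd (d : ℕ) : Type := Fin d → ℝ
abbrev Td (d : ℕ) : Type := Fin d → AddCircle (1 : ℝ)

instance factOneposR : Fact ((0:ℝ) < 1) := ⟨one_pos⟩

/-- The canonical measurable section of the torus, with values in `[0,1)^d`. -/
def secT {d : ℕ} (y : Td d) : Vd d := fun i => ((AddCircle.equivIco 1 0) (y i)).1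

/-- The vector of `ℝ^d` associated with an integer vector. -/
def intVec {d : ℕ} (z : Fin d → ℤ) : Vd d := fun i => (z i : ℝ)

/-- Euclidean scalar product on `ℝ^d`. -/
def dotp {d : ℕ} (a b : Vd d) : ℝ := ∑ i, a i * b i

/-- Squared euclidean norm on `ℝ^d`. -/
def sqnorm {d : ℕ} (a : Vd d) : ℝ := ∑ i, (a i)^2

/-- Spatial gradient. -/
def gradv {d : ℕ} (g : Vd d → ℝ) (x : Vd d) : Vd d := fun i => fderiv ℝ g x (Pi.single i 1)

/-- Second derivative of `g` at `x` in the directions `v, w`. -/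
def D2 {d : ℕ} (g : Vd d → ℝ) (x v w : Vd d) : ℝ := fderiv ℝ (fun y => fderiv ℝ g y v) x w

/-- Laplacian. -/
def lapl {d : ℕ} (g : Vd d → ℝ) (x : Vd d) : ℝ := ∑ i, D2 g x (Pi.single i 1) (Pi.single i 1)

/-- Divergence of a vector field. -/
def divv {d : ℕ} (b : Vd d → Vd d) (x : Vd d) : ℝ :=
  ∑ i, fderiv ℝ (fun y => b y i) x (Pi.single i 1)

/-- Time derivative of a time dependent function. -/
def tderiv {d : ℕ} (u : ℝ → Vd d → ℝ) (t : ℝ) (x : Vd d) : ℝ := deriv (fun s => u s x) t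

abbrev PTd (d : ℕ) := ProbabilityMeasure (Td d)

/-- The 1-Wasserstein (Monge--Kantorovich) distance, via Kantorovich duality. -/
def W1 {d : ℕ} (μ ν : PTd d) : ℝ :=
  sSup { r | ∃ φ : Td d → ℝ, LipschitzWith 1 φ ∧
    r = (∫ y, φ y ∂(μ : Measure (Td d))) - ∫ y, φ y ∂(ν : Measure (Td d)) }

/-- The convex combination `(1-t) μ + t ν`. -/
def lineComb {d : ℕ} (t : ℝ) (μ ν : PTd d) : Measure (Td d) :=
  ENNReal.ofReal (1 - t) • (μ : Measure (Td d)) + ENNReal.ofReal t • (ν : Measure (Td d))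

/-- The standing assumptions of the paper: a Hamiltonian `H` (a `ℤ^d`-periodic function of
`(x,p)`), its convex conjugate `Hstar` in the `p` variable, a `C²` coupling function
`Fc` on `P(𝕋^d)` with flat derivative `Fd` (represented by periodic functions on `ℝ^d`),
with the regularity and growth conditions of the paper. -/
structure MFGSetting (d : ℕ) where
  H : Vd d → Vd d → ℝ
  Hstar : Vd d → Vd d → ℝ
  Fc : PTd d → ℝ
  Fd : Measure (Td d) → Vd d → ℝ
  Cbar : ℝ
  Cbar_pos : 0 < Cbar
  θ : ℝ
  θ_mem : θ ∈ Set.Ioo (0:ℝ) 1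
  Cg : ℝ
  Cg_pos : 0 < Cg
  CF : ℝ
  H_smooth : ContDiff ℝ 2 (fun q : Vd d × Vd d => H q.1 q.2)
  H_per : ∀ (x : Vd d) (z : Fin d → ℤ) (p : Vd d), H (x + intVec z) p = H x p
  Dpp_lip : ∃ L : ℝ, 0 ≤ L ∧ ∀ (x p₁ p₂ v w : Vd d),
    |D2 (fun p => H x p) p₁ v w - D2 (fun p => H x p) p₂ v w| ≤ L * ‖p₁ - p₂‖ * ‖v‖ * ‖w‖
  Dpp_lower : ∀ x p v : Vd d, Cbar⁻¹ * sqnorm v ≤ D2 (fun p' => H x p') p v v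
  Dpp_upper : ∀ x p v : Vd d, D2 (fun p' => H x p') p v v ≤ Cbar * sqnorm v
  Dxx_growth : ∀ x p v w : Vd d,
    |D2 (fun x' => H x' p) x v w| ≤ Cg * (1 + ‖p‖) ^ (1 + θ) * ‖v‖ * ‖w‖
  Dxp_growth : ∀ x p v w : Vd d,
    |fderiv ℝ (fun x' => fderiv ℝ (fun p' => H x' p') p v) x w| ≤ Cg * (1 + ‖p‖) ^ θ * ‖v‖ * ‖w‖
  Hstar_eq : ∀ x q : Vd d, IsLUB (Set.range fun p => dotp q p - H x p) (Hstar x q)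
  Fd_per : ∀ (μ : Measure (Td d)) (x : Vd d) (z : Fin d → ℤ), Fd μ (x + intVec z) = Fd μ x
  Fd_smooth : ∀ μ : Measure (Td d), IsProbabilityMeasure μ → ContDiff ℝ 2 (Fd μ)
  Fd_D2_bound : ∀ μ : Measure (Td d), IsProbabilityMeasure μ →
    ∀ x v w : Vd d, |D2 (Fd μ) x v w| ≤ CF * ‖v‖ * ‖w‖
  flat_deriv : ∀ μ ν : PTd d,
    Fc ν - Fc μ = ∫ t in Set.Icc (0:ℝ) 1,
      ((∫ y, Fd (lineComb t μ ν) (secT y) ∂(ν : Measure (Td d))) -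
        ∫ y, Fd (lineComb t μ ν) (secT y) ∂(μ : Measure (Td d)))
  Fd_normalized : ∀ μ : PTd d, (∫ y, Fd (μ : Measure (Td d)) (secT y) ∂(μ : Measure (Td d))) = 0
  Fc_bounded : ∃ M : ℝ, ∀ μ : PTd d, |Fc μ| ≤ M
  Fd_bounded : ∃ M : ℝ, ∀ (μ : PTd d) (x : Vd d), |Fd (μ : Measure (Td d)) x| ≤ M

/-- Smooth periodic test functions on `[0,∞) × 𝕋^d` (resp. `ℝ × 𝕋^d`). -/
def IsTestFun {d : ℕ} (φ : ℝ → Vd d → ℝ) : Prop :=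
  ContDiff ℝ 2 (fun q : ℝ × Vd d => φ q.1 q.2) ∧
  ∀ (t : ℝ) (x : Vd d) (z : Fin d → ℤ), φ t (x + intVec z) = φ t x

/-- The weak (distributional) formulation of the Fokker--Planck equation
`-∂ₜ m + σ Δ m + div(m α) = 0` between times `s₁` and `s₂`. -/
def FPeq {d : ℕ} (σ : ℝ) (m : ℝ → PTd d) (α : ℝ → Td d → Vd d) (s₁ s₂ : ℝ) : Prop :=
  ∀ φ : ℝ → Vd d → ℝ, IsTestFun φ →
    (∫ y, φ s₂ (secT y) ∂(m s₂ : Measure (Td d))) -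
      (∫ y, φ s₁ (secT y) ∂(m s₁ : Measure (Td d))) =
    ∫ s in s₁..s₂, ∫ y, (tderiv φ s (secT y) + σ * lapl (φ s) (secT y)
        - dotp (α s y) (gradv (φ s) (secT y))) ∂(m s : Measure (Td d))

/-- Continuity of a curve of measures with respect to the 1-Wasserstein distance. -/
def W1ContOn {d : ℕ} (m : ℝ → PTd d) (I : Set ℝ) : Prop :=
  ∀ t ∈ I, ∀ ε > 0, ∃ η > 0, ∀ s ∈ I, |s - t| < η → W1 (m s) (m t) < ε

/-- Continuity of a function on `P(𝕋^d)` with respect to the 1-Wasserstein distance. -/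
def W1Continuous {d : ℕ} (χ : PTd d → ℝ) : Prop :=
  ∀ μ : PTd d, ∀ ε > 0, ∃ η > 0, ∀ ν : PTd d, W1 μ ν < η → |χ ν - χ μ| < ε

/-- W1-closed subsets of `P(𝕋^d)`. -/
def IsClosedW1 {d : ℕ} (C : Set (PTd d)) : Prop :=
  ∀ μ : PTd d, (∀ ε > 0, ∃ ν ∈ C, W1 μ ν < ε) → μ ∈ C

/-- The running cost `∫ H*(x,α(s)) dm(s) + 𝓕(m(s))`. -/
def runCost {d : ℕ} (S : MFGSetting d) (m : ℝ → PTd d) (α : ℝ → Td d → Vd d) (s : ℝ) : ℝ :=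
  (∫ y, S.Hstar (secT y) (α s y) ∂(m s : Measure (Td d))) + S.Fc (m s)

/-- Admissible pairs `(m,α)` on `[0,T]` starting from `m₀` (with `α ∈ L²_m`). -/
def AdmOn {d : ℕ} (S : MFGSetting d) (σ : ℝ) (m₀ : PTd d) (T : ℝ)
    (m : ℝ → PTd d) (α : ℝ → Td d → Vd d) : Prop :=
  m 0 = m₀ ∧ W1ContOn m (Set.Icc 0 T) ∧
  (∀ s₁ s₂ : ℝ, 0 ≤ s₁ → s₁ ≤ s₂ → s₂ ≤ T → FPeq σ m α s₁ s₂) ∧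
  Measurable (fun q : ℝ × Td d => α q.1 q.2) ∧
  (∫⁻ s in Set.Ioc (0:ℝ) T, ∫⁻ y, ENNReal.ofReal (sqnorm (α s y)) ∂(m s : Measure (Td d))) < ⊤ ∧
  IntervalIntegrable (runCost S m α) volume 0 T

/-- Admissible pairs `(m,α)` on `[0,T]` starting from `m₀`, with `α` merely in `L¹_m`
(the class `Π_T` used for problems with prescribed endpoints). -/
def AdmOn1 {d : ℕ} (S : MFGSetting d) (σ : ℝ) (m₀ : PTd d) (T : ℝ)
    (m : ℝ → PTd d) (α : ℝ → Td d → Vd d) : Prop :=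
  m 0 = m₀ ∧ W1ContOn m (Set.Icc 0 T) ∧
  (∀ s₁ s₂ : ℝ, 0 ≤ s₁ → s₁ ≤ s₂ → s₂ ≤ T → FPeq σ m α s₁ s₂) ∧
  Measurable (fun q : ℝ × Td d => α q.1 q.2) ∧
  (∫⁻ s in Set.Ioc (0:ℝ) T, ∫⁻ y, ENNReal.ofReal (Real.sqrt (sqnorm (α s y)))
      ∂(m s : Measure (Td d))) < ⊤ ∧
  IntervalIntegrable (runCost S m α) volume 0 T

/-- The finite horizon cost. -/
def costT {d : ℕ} (S : MFGSetting d) (m : ℝ → PTd d) (α : ℝ → Td d → Vd d) (T : ℝ) : ℝ :=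
  ∫ s in (0:ℝ)..T, runCost S m α s

/-- The value `𝒰(T,m₀)` of the finite horizon problem. -/
def Ufun {d : ℕ} (S : MFGSetting d) (σ : ℝ) (T : ℝ) (m₀ : PTd d) : ℝ :=
  sInf { r | ∃ m α, AdmOn S σ m₀ T m α ∧ r = costT S m α T }

/-- Admissible pairs for the infinite horizon `δ`-discounted problem. -/
def AdmDisc {d : ℕ} (S : MFGSetting d) (σ : ℝ) (δ : ℝ) (m₀ : PTd d)
    (m : ℝ → PTd d) (α : ℝ → Td d → Vd d) : Prop :=
  m 0 = m₀ ∧ W1ContOn m (Set.Ici 0) ∧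
  (∀ s₁ s₂ : ℝ, 0 ≤ s₁ → s₁ ≤ s₂ → FPeq σ m α s₁ s₂) ∧
  Measurable (fun q : ℝ × Td d => α q.1 q.2) ∧
  (∫⁻ s in Set.Ioi (0:ℝ), ENNReal.ofReal (Real.exp (-δ * s)) *
      ∫⁻ y, ENNReal.ofReal (sqnorm (α s y)) ∂(m s : Measure (Td d))) < ⊤ ∧
  Integrable (fun s => Real.exp (-δ * s) * runCost S m α s) (volume.restrict (Set.Ioi 0))

/-- The discounted cost. -/
def costDisc {d : ℕ} (S : MFGSetting d) (δ : ℝ) (m : ℝ → PTd d) (α : ℝ → Td d → Vd d) : ℝ :=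
  ∫ s in Set.Ioi (0:ℝ), Real.exp (-δ * s) * runCost S m α s

/-- The value `𝒱_δ(m₀)` of the discounted problem. -/
def Vfun {d : ℕ} (S : MFGSetting d) (σ : ℝ) (δ : ℝ) (m₀ : PTd d) : ℝ :=
  sInf { r | ∃ m α, AdmDisc S σ δ m₀ m α ∧ r = costDisc S δ m α }

/-- `D_p H (x, p)`. -/
def DpH {d : ℕ} (S : MFGSetting d) (x p : Vd d) : Vd d :=
  fun i => fderiv ℝ (fun p' => S.H x p') p (Pi.single i 1)

/-- `C^{1,2}` regularity on `I × 𝕋^d` of a (periodic) time-dependent function. -/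
def Creg12 {d : ℕ} (u : ℝ → Vd d → ℝ) (I : Set ℝ) : Prop :=
  ContinuousOn (fun q : ℝ × Vd d => u q.1 q.2) (I ×ˢ Set.univ) ∧
  (∀ x : Vd d, ∀ t ∈ I, DifferentiableAt ℝ (fun s => u s x) t) ∧
  (∀ t ∈ I, ContDiff ℝ 2 (u t)) ∧
  (∀ t ∈ I, ∀ (x : Vd d) (z : Fin d → ℤ), u t (x + intVec z) = u t x)

/-- `(u,m)` is a classical solution of the `δ`-discounted MFG system on `[0,∞) × 𝕋^d`:
`-∂ₜ u - Δ u + δ u + H(x,Du) = F(x,m)` and `-∂ₜ m + Δ m + div(m D_pH(x,Du)) = 0`. -/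
def SolvesDiscMFG {d : ℕ} (S : MFGSetting d) (δ : ℝ) (u : ℝ → Vd d → ℝ) (m : ℝ → PTd d) : Prop :=
  Creg12 u (Set.Ici 0) ∧
  (∀ t ∈ Set.Ici (0:ℝ), ∀ x : Vd d,
    - tderiv u t x - lapl (u t) x + δ * u t x + S.H x (gradv (u t) x)
      = S.Fd (m t : Measure (Td d)) x) ∧
  W1ContOn m (Set.Ici 0) ∧
  (∀ s₁ s₂ : ℝ, 0 ≤ s₁ → s₁ ≤ s₂ →
    FPeq 1 m (fun s y => DpH S (secT y) (gradv (u s) (secT y))) s₁ s₂)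

/-- Admissible pairs for the stationary (ergodic) problem:
`σ Δ m + div(m α) = 0` in the sense of distributions and `α ∈ L²_m`. -/
def StatAdm {d : ℕ} (σ : ℝ) (m : PTd d) (α : Td d → Vd d) : Prop :=
  Measurable α ∧
  (∫⁻ y, ENNReal.ofReal (sqnorm (α y)) ∂(m : Measure (Td d))) < ⊤ ∧
  ∀ g : Vd d → ℝ, ContDiff ℝ 2 g → (∀ (x : Vd d) (z : Fin d → ℤ), g (x + intVec z) = g x) →
    (∫ y, (σ * lapl g (secT y) - dotp (α y) (gradv g (secT y))) ∂(m : Measure (Td d))) = 0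

/-- `ergInf S σ = -λ̄`, the value of the stationary minimization problem. -/
def ergInf {d : ℕ} (S : MFGSetting d) (σ : ℝ) : ℝ :=
  sInf { r | ∃ m α, StatAdm σ m α ∧
    r = (∫ y, S.Hstar (secT y) (α y) ∂(m : Measure (Td d))) + S.Fc m }

/-- The set of values over which the dynamic programming principle for a corrector
`χ` takes its infimum. -/
def DPPval {d : ℕ} (S : MFGSetting d) (σ : ℝ) (χ : PTd d → ℝ) (lam t : ℝ) (m₀ : PTd d) :
    Set ℝ :=
  { r | ∃ m α, AdmOn S σ m₀ t m α ∧
      r = (∫ s in (0:ℝ)..t, runCost S m α s) + χ (m t) + lam * t }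

/-- `χ` is a corrector function: it is continuous and satisfies the dynamic
programming principle with the critical value `λ`. -/
def IsCorrector {d : ℕ} (S : MFGSetting d) (σ : ℝ) (lam : ℝ) (χ : PTd d → ℝ) : Prop :=
  W1Continuous χ ∧ ∀ (m₀ : PTd d) (t : ℝ), 0 < t → χ m₀ = sInf (DPPval S σ χ lam t m₀)

/-- `(m,α)` is a calibrated curve (defined on all of `ℝ`). -/
def IsCalibrated {d : ℕ} (S : MFGSetting d) (σ : ℝ) (lam : ℝ)
    (m : ℝ → PTd d) (α : ℝ → Td d → Vd d) : Prop :=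
  W1ContOn m Set.univ ∧
  (∀ s₁ s₂ : ℝ, s₁ ≤ s₂ → FPeq σ m α s₁ s₂) ∧
  Measurable (fun q : ℝ × Td d => α q.1 q.2) ∧
  (∀ t₁ t₂ : ℝ, (∫⁻ s in Set.Ioc t₁ t₂,
      ∫⁻ y, ENNReal.ofReal (sqnorm (α s y)) ∂(m s : Measure (Td d))) < ⊤) ∧
  (∀ t₁ t₂ : ℝ, IntervalIntegrable (runCost S m α) volume t₁ t₂) ∧
  ∃ χ : PTd d → ℝ, IsCorrector S σ lam χ ∧ ∀ t₁ t₂ : ℝ, t₁ < t₂ →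
    χ (m t₁) = lam * (t₂ - t₁) + (∫ s in t₁..t₂, runCost S m α s) + χ (m t₂)

/-- The projected Mather set. -/
def MatherSet {d : ℕ} (S : MFGSetting d) (σ : ℝ) (lam : ℝ) : Set (PTd d) :=
  { μ | ∃ m α, IsCalibrated S σ lam m α ∧ m 0 = μ }

/-- Invariant subsets of the projected Mather set. -/
def IsInvariantMFG {d : ℕ} (S : MFGSetting d) (σ : ℝ) (lam : ℝ) (C : Set (PTd d)) : Prop :=
  ∀ μ ∈ C, ∃ m α, IsCalibrated S σ lam m α ∧ m 0 = μ ∧ ∀ t : ℝ, m t ∈ C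

/-- Minimal invariant subsets of the projected Mather set. -/
def IsMinimalInvariant {d : ℕ} (S : MFGSetting d) (σ : ℝ) (lam : ℝ) (N : Set (PTd d)) : Prop :=
  N.Nonempty ∧ N ⊆ MatherSet S σ lam ∧ IsClosedW1 N ∧ IsInvariantMFG S σ lam N ∧
  ∀ C : Set (PTd d), C ⊆ N → C.Nonempty → IsClosedW1 C → IsInvariantMFG S σ lam C → C = N

/-- `δ 𝒱_δ → -λ` uniformly as `δ → 0⁺`. -/
def IsLimitValueV {d : ℕ} (S : MFGSetting d) (σ : ℝ) (lam : ℝ) : Prop :=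
  ∀ ε > 0, ∃ δ₀ > 0, ∀ δ : ℝ, 0 < δ → δ ≤ δ₀ → ∀ μ : PTd d,
    |δ * Vfun S σ δ μ - (-lam)| < ε

/-- `𝒰(T,·)/T → -λ` uniformly as `T → ∞`. -/
def IsLimitValueU {d : ℕ} (S : MFGSetting d) (σ : ℝ) (lam : ℝ) : Prop :=
  ∀ ε > 0, ∃ T₀ : ℝ, ∀ T : ℝ, T₀ ≤ T → ∀ μ : PTd d,
    |Ufun S σ T μ / T - (-lam)| < ε

/-- A function `Φ` on `P(𝕋^d)` is `C¹` with flat derivative `dΦ` (normalized so that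
`∫ dΦ(m,·) dm = 0`, periodic in the space variable and jointly continuous). -/
def IsC1Flat {d : ℕ} (Φ : PTd d → ℝ) (dΦ : Measure (Td d) → Vd d → ℝ) : Prop :=
  (∀ (μ : Measure (Td d)) (x : Vd d) (z : Fin d → ℤ), dΦ μ (x + intVec z) = dΦ μ x) ∧
  (∀ μ ν : PTd d,
    Φ ν - Φ μ = ∫ t in Set.Icc (0:ℝ) 1,
      ((∫ y, dΦ (lineComb t μ ν) (secT y) ∂(ν : Measure (Td d))) -
        ∫ y, dΦ (lineComb t μ ν) (secT y) ∂(μ : Measure (Td d)))) ∧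
  (∀ μ : PTd d, (∫ y, dΦ (μ : Measure (Td d)) (secT y) ∂(μ : Measure (Td d))) = 0) ∧
  (∀ ε > 0, ∀ (μ : PTd d) (x : Vd d), ∃ η > 0, ∀ (ν : PTd d) (x' : Vd d),
    W1 μ ν < η → ‖x' - x‖ < η → |dΦ (ν : Measure (Td d)) x' - dΦ (μ : Measure (Td d)) x| < ε)

lemma lv_int_of_lip {d : ℕ} (μ : PTd d) {K : NNReal} {f : Td d → ℝ} (hf : LipschitzWith K f) :
    Integrable f (μ : Measure (Td d)) := by
  have := (BoundedContinuousFunction.mkOfCompact ⟨f, hf.continuous⟩).integrable (μ : Measure (Td d))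
  exact this

lemma lv_W1_bdd {d : ℕ} (μ ν : PTd d) : BddAbove { r | ∃ φ : Td d → ℝ, LipschitzWith 1 φ ∧
    r = (∫ y, φ y ∂(μ : Measure (Td d))) - ∫ y, φ y ∂(ν : Measure (Td d)) } := by
  have hb : Bornology.IsBounded (univ : Set (Td d)) := isCompact_univ.isBounded
  set D := Metric.diam (univ : Set (Td d)) with hD
  refine ⟨2 * D, ?_⟩
  rintro r ⟨φ, hφ, rfl⟩
  have h1 : ∀ y, |φ y - φ 0| ≤ D := by
    intro y
    have := hφ.dist_le_mul y 0
    rw [Real.dist_eq] at this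
    have h2 := Metric.dist_le_diam_of_mem hb (mem_univ y) (mem_univ 0)
    rw [NNReal.coe_one, one_mul] at this
    linarith
  have hμ : ∫ y, φ y ∂(μ : Measure (Td d)) ≤ φ 0 + D := by
    calc ∫ y, φ y ∂(μ : Measure (Td d)) ≤ ∫ y, (φ 0 + D) ∂(μ : Measure (Td d)) := by
          apply integral_mono (lv_int_of_lip μ hφ) (integrable_const _)
          intro y
          have := (abs_le.1 (h1 y)).2
          simp only; linarith
      _ = _ := by simp
  have hν : φ 0 - D ≤ ∫ y, φ y ∂(ν : Measure (Td d)) := by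
    calc φ 0 - D = ∫ y, (φ 0 - D) ∂(ν : Measure (Td d)) := by simp
      _ ≤ _ := by
          apply integral_mono (integrable_const _) (lv_int_of_lip ν hφ)
          intro y
          have := (abs_le.1 (h1 y)).1
          simp only; linarith
  linarith

lemma lv_le_W1 {d : ℕ} (μ ν : PTd d) {φ : Td d → ℝ} (h : LipschitzWith 1 φ) :
    (∫ y, φ y ∂(μ : Measure (Td d))) - ∫ y, φ y ∂(ν : Measure (Td d)) ≤ W1 μ ν :=
  le_csSup (lv_W1_bdd μ ν) ⟨φ, h, rfl⟩

lemma lv_abs_W1 {d : ℕ} (μ ν : PTd d) {K : NNReal} {f : Td d → ℝ} (hf : LipschitzWith K f) :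
    |(∫ y, f y ∂(μ : Measure (Td d))) - ∫ y, f y ∂(ν : Measure (Td d))| ≤ ((K:ℝ) + 1) * W1 μ ν := by
  have hK : (0:ℝ) < (K:ℝ) + 1 := by positivity
  have key : ∀ σ : ℝ, |σ| = 1 → σ * ((∫ y, f y ∂(μ : Measure (Td d))) - ∫ y, f y ∂(ν : Measure (Td d)))
      ≤ ((K:ℝ) + 1) * W1 μ ν := by
    intro σ hσ
    have : LipschitzWith 1 (fun y => σ / ((K:ℝ) + 1) * f y) := by
      apply LipschitzWith.of_dist_le_mul
      intro x y
      have h1 := hf.dist_le_mul x y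
      rw [Real.dist_eq] at h1 ⊢
      rw [← mul_sub, abs_mul, abs_div, hσ, abs_of_pos hK, NNReal.coe_one, one_mul, one_div,
        inv_mul_le_iff₀ hK]
      have : 0 ≤ dist x y := dist_nonneg
      nlinarith
    have h2 := lv_le_W1 μ ν this
    rw [integral_const_mul, integral_const_mul, ← mul_sub, div_mul_eq_mul_div, div_le_iff₀ hK] at h2
    linarith
  rw [abs_le']
  constructor
  · simpa using key 1 (by simp)
  · have := key (-1) (by simp)
    simpa using this

lemma lv_contOn {d : ℕ} {m : ℝ → PTd d} {I : Set ℝ} (hm : W1ContOn m I) {K : NNReal} {f : Td d → ℝ}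
    (hf : LipschitzWith K f) : ContinuousOn (fun s => ∫ y, f y ∂(m s : Measure (Td d))) I := by
  intro t ht
  rw [Metric.continuousWithinAt_iff]
  intro ε hε
  obtain ⟨η, hη, h⟩ := hm t ht (ε / ((K:ℝ) + 1)) (by positivity)
  refine ⟨η, hη, fun {s} hs hst => ?_⟩
  have h1 := h s hs (by rwa [Real.dist_eq] at hst)
  rw [Real.dist_eq]
  have h2 := lv_abs_W1 (m s) (m t) hf
  rw [lt_div_iff₀ (by positivity)] at h1
  linarith

lemma lv_meas {d : ℕ} {m : ℝ → PTd d} {I : Set ℝ} (hm : W1ContOn m I) {r : ℝ → ℝ}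
    (hr : Continuous r) (hrI : ∀ s, r s ∈ I) :
    Measurable (fun s => (m (r s) : Measure (Td d))) := by
  refine Measurable.measure_of_isPiSystem_of_isProbabilityMeasure
    (S := {s : Set (Td d) | IsClosed s}) ?_ isPiSystem_isClosed ?_
  · rw [← borel_eq_generateFrom_isClosed]; exact BorelSpace.measurable_eq
  intro F hF
  have hpos : ∀ n : ℕ, (0:ℝ) < 1 / ((n:ℝ) + 1) := fun n => by positivity
  have key : Measurable (fun s => (m (r s) : Measure (Td d)).real F) := by
    refine measurable_of_tendsto_metrizable (f := fun (n : ℕ) s =>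
      ∫ y, ((thickenedIndicator (hpos n) F y : NNReal) : ℝ) ∂(m (r s) : Measure (Td d))) ?_ ?_
    · intro n
      have hl : LipschitzWith (1 * (1 / ((n:ℝ) + 1)).toNNReal⁻¹)
          (fun y => ((thickenedIndicator (hpos n) F y : NNReal) : ℝ)) := by
        have := lipschitzWith_thickenedIndicator (hpos n) F
        exact LipschitzWith.comp (NNReal.isometry_coe.lipschitz) this
      have h1 := lv_contOn hm hl
      have : Continuous (fun s => ∫ y, ((thickenedIndicator (hpos n) F y : NNReal) : ℝ)
          ∂(m (r s) : Measure (Td d))) := h1.comp_continuous hr hrI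
      exact this.measurable
    · rw [tendsto_pi_nhds]
      intro s
      exact tendsto_integral_thickenedIndicator_of_isClosed _ hF hpos
        tendsto_one_div_add_atTop_nhds_zero_nat
  have := key.ennreal_ofReal
  simpa using this

lemma lv_kernel_int {d : ℕ} {m : ℝ → PTd d} {I : Set ℝ} (hm : W1ContOn m I) {r : ℝ → ℝ}
    (hr : Continuous r) (hrI : ∀ s, r s ∈ I) {G : ℝ × Td d → ℝ} (hG : Measurable G) :
    StronglyMeasurable (fun s => ∫ y, G (s, y) ∂(m (r s) : Measure (Td d))) := by
  let κ : ProbabilityTheory.Kernel ℝ (Td d) := ⟨fun s => (m (r s) : Measure (Td d)), lv_meas hm hr hrI⟩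
  have : ProbabilityTheory.IsMarkovKernel κ := ⟨fun s => by
    change IsProbabilityMeasure (m (r s) : Measure (Td d)); infer_instance⟩
  exact hG.stronglyMeasurable.integral_kernel_prod_right' (κ := κ)

lemma lv_kernel_aesm {d : ℕ} {m : ℝ → PTd d} {a b : ℝ} (hab : a ≤ b) (hm : W1ContOn m (Icc a b))
    {G : ℝ × Td d → ℝ} (hG : Measurable G) :
    AEStronglyMeasurable (fun s => ∫ y, G (s, y) ∂(m s : Measure (Td d)))
      (volume.restrict (Ioc a b)) := by
  refine ⟨_, lv_kernel_int hm (r := fun s => max a (min s b)) (by fun_prop)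
    (fun s => ⟨le_max_left _ _, max_le hab (min_le_right _ _)⟩) hG, ?_⟩
  refine (ae_restrict_iff' measurableSet_Ioc).2 (Eventually.of_forall fun s hs => ?_)
  simp only
  rw [min_eq_left hs.2, max_eq_right hs.1.le]

lemma lv_W1ContOn_mono {d : ℕ} {m : ℝ → PTd d} {I J : Set ℝ} (hm : W1ContOn m I) (h : J ⊆ I) :
    W1ContOn m J := by
  intro t ht ε hε
  obtain ⟨η, hη, H⟩ := hm t (h ht) ε hε
  exact ⟨η, hη, fun s hs => H s (h hs)⟩

/-- projection to the torus -/
def lvproj {d : ℕ} (v : Vd d) : Td d := fun i => (v i : AddCircle (1:ℝ))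

lemma lv_secT_meas {d : ℕ} : Measurable (secT : Td d → Vd d) := by
  refine measurable_pi_lambda _ fun i => ?_
  have : Measurable (fun y : AddCircle (1:ℝ) => ((AddCircle.equivIco 1 0) y).1) :=
    measurable_subtype_coe.comp (AddCircle.measurableEquivIco 1 0).measurable
  exact this.comp (measurable_pi_apply i)

lemma lv_secT_mem {d : ℕ} (y : Td d) : secT y ∈ Icc (0 : Vd d) 1 := by
  constructor
  · intro i; exact ((AddCircle.equivIco 1 0) (y i)).2.1
  · intro i; have := ((AddCircle.equivIco 1 0) (y i)).2.2; exact this.le.trans (by simp)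

lemma lv_proj_secT {d : ℕ} (y : Td d) : lvproj (secT y) = y := by
  funext i
  exact (AddCircle.equivIco 1 0).symm_apply_apply (y i)

lemma lv_proj_add {d : ℕ} (v w : Vd d) : lvproj (v + w) = lvproj v + lvproj w := by
  funext i; simp [lvproj]

lemma lv_eq_of_proj {d : ℕ} {v w : Vd d} (h : lvproj v = lvproj w) : ∃ z, v = w + intVec z := by
  have : ∀ i, ∃ z : ℤ, v i = w i + z := by
    intro i
    have h1 : ((v i : ℝ) : AddCircle (1:ℝ)) = (w i : ℝ) := congrFun h i
    have h2 : ((v i - w i : ℝ) : AddCircle (1:ℝ)) = 0 := by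
      rw [AddCircle.coe_sub, h1, sub_self]
    rw [AddCircle.coe_eq_zero_iff] at h2
    obtain ⟨n, hn⟩ := h2
    refine ⟨n, ?_⟩
    simp at hn
    linarith
  choose z hz using this
  exact ⟨z, funext fun i => by simp [intVec, hz]⟩

lemma lv_per {d : ℕ} {f : Vd d → ℝ} (hf : ∀ x z, f (x + intVec z) = f x) (y : Td d) (v : Vd d) :
    f (secT (y + lvproj v)) = f (secT y + v) := by
  have : lvproj (secT (y + lvproj v)) = lvproj (secT y + v) := by
    rw [lv_proj_secT, lv_proj_add, lv_proj_secT]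
  obtain ⟨z, hz⟩ := lv_eq_of_proj this
  rw [hz, hf]

lemma lv_proj_lip {d : ℕ} : LipschitzWith 1 (lvproj : Vd d → Td d) := by
  apply LipschitzWith.of_dist_le_mul
  intro x y
  rw [NNReal.coe_one, one_mul]
  refine (dist_pi_le_iff dist_nonneg).2 fun i => ?_
  have h1 : dist (lvproj x i) (lvproj y i) ≤ dist (x i) (y i) := by
    simp only [lvproj]
    rw [dist_eq_norm, dist_eq_norm, ← AddCircle.coe_sub]
    exact QuotientAddGroup.norm_mk_le_norm
  exact h1.trans (dist_le_pi_dist x y i)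

lemma lv_partx {d : ℕ} {Ψ : ℝ × Vd d → ℝ} {t : ℝ} {x : Vd d} (h : DifferentiableAt ℝ Ψ (t, x))
    (v : Vd d) : fderiv ℝ (fun x' => Ψ (t, x')) x v = fderiv ℝ Ψ (t, x) (0, v) := by
  have h1 : HasFDerivAt (fun x' : Vd d => (t, x')) (ContinuousLinearMap.inr ℝ ℝ (Vd d)) x :=
    hasFDerivAt_prodMk_right t x
  have := (h.hasFDerivAt.comp x h1).fderiv
  change fderiv ℝ (Ψ ∘ fun x' => (t, x')) x v = _
  rw [this]; simp

lemma lv_partt {d : ℕ} {Ψ : ℝ × Vd d → ℝ} {t : ℝ} {x : Vd d} (h : DifferentiableAt ℝ Ψ (t, x)) :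
    deriv (fun t' => Ψ (t', x)) t = fderiv ℝ Ψ (t, x) (1, 0) := by
  have h1 : HasDerivAt (fun t' : ℝ => (t', x)) ((1:ℝ), (0 : Vd d)) t :=
    (hasDerivAt_id t).prodMk (hasDerivAt_const t x)
  exact (h.hasFDerivAt.comp_hasDerivAt t h1).deriv

section tests
variable {d : ℕ} {φ : ℝ → Vd d → ℝ}

lemma lv_grad_eq (hφ : ContDiff ℝ 2 (fun q : ℝ × Vd d => φ q.1 q.2)) (t : ℝ) (x v : Vd d) :
    fderiv ℝ (φ t) x v = fderiv ℝ (fun q : ℝ × Vd d => φ q.1 q.2) (t, x) (0, v) :=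
  lv_partx (Ψ := fun q : ℝ × Vd d => φ q.1 q.2) (hφ.differentiable (by norm_num) _) v

lemma lv_td_eq (hφ : ContDiff ℝ 2 (fun q : ℝ × Vd d => φ q.1 q.2)) (t : ℝ) (x : Vd d) :
    tderiv φ t x = fderiv ℝ (fun q : ℝ × Vd d => φ q.1 q.2) (t, x) (1, 0) :=
  lv_partt (Ψ := fun q : ℝ × Vd d => φ q.1 q.2) (hφ.differentiable (by norm_num) _)

lemma lv_fd_C1 (hφ : ContDiff ℝ 2 (fun q : ℝ × Vd d => φ q.1 q.2)) (w : ℝ × Vd d) :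
    ContDiff ℝ 1 (fun q => fderiv ℝ (fun q : ℝ × Vd d => φ q.1 q.2) q w) :=
  (hφ.fderiv_right (m := 1) (by norm_num)).clm_apply contDiff_const

lemma lv_D2_eq (hφ : ContDiff ℝ 2 (fun q : ℝ × Vd d => φ q.1 q.2)) (t : ℝ) (x v w : Vd d) :
    D2 (φ t) x v w = fderiv ℝ (fun q => fderiv ℝ (fun q : ℝ × Vd d => φ q.1 q.2) q (0, v)) (t, x)
      (0, w) := by
  unfold D2
  simp_rw [lv_grad_eq hφ]
  exact lv_partx (Ψ := fun q => fderiv ℝ (fun q : ℝ × Vd d => φ q.1 q.2) q (0, v))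
    ((lv_fd_C1 hφ _).differentiable (by norm_num) _) w

lemma lv_td_cont (hφ : ContDiff ℝ 2 (fun q : ℝ × Vd d => φ q.1 q.2)) :
    Continuous (fun q : ℝ × Vd d => tderiv φ q.1 q.2) := by
  simp_rw [lv_td_eq hφ]
  exact (lv_fd_C1 hφ _).continuous

lemma lv_gr_cont (hφ : ContDiff ℝ 2 (fun q : ℝ × Vd d => φ q.1 q.2)) (i : Fin d) :
    Continuous (fun q : ℝ × Vd d => gradv (φ q.1) q.2 i) := by
  unfold gradv
  simp_rw [lv_grad_eq hφ]
  exact (lv_fd_C1 hφ _).continuous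

lemma lv_la_cont (hφ : ContDiff ℝ 2 (fun q : ℝ × Vd d => φ q.1 q.2)) :
    Continuous (fun q : ℝ × Vd d => lapl (φ q.1) q.2) := by
  unfold lapl
  simp_rw [lv_D2_eq hφ]
  refine continuous_finsetSum _ fun i _ => ?_
  exact ((lv_fd_C1 hφ _).continuous_fderiv (by norm_num)).clm_apply continuous_const

lemma lv_cpt_bd {K : ℝ × Vd d → ℝ} (hK : Continuous K) (a b : ℝ) :
    ∃ C : ℝ, 0 ≤ C ∧ ∀ s ∈ Icc a b, ∀ y : Td d, |K (s, secT y)| ≤ C := by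
  have hc : IsCompact (Icc a b ×ˢ Icc (0 : Vd d) 1) := isCompact_Icc.prod isCompact_Icc
  obtain ⟨C, hC⟩ := hc.exists_bound_of_continuousOn hK.continuousOn
  refine ⟨max C 0, le_max_right _ _, fun s hs y => ?_⟩
  exact (hC (s, secT y) ⟨hs, lv_secT_mem y⟩).trans (le_max_left _ _)

lemma lv_sq_nonneg (v : Vd d) : 0 ≤ sqnorm v := Finset.sum_nonneg fun i _ => sq_nonneg _

lemma lv_FPG_bd (hφ : ContDiff ℝ 2 (fun q : ℝ × Vd d => φ q.1 q.2)) (σ a b : ℝ) :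
    ∃ C : ℝ, 0 ≤ C ∧ ∀ s ∈ Icc a b, ∀ (y : Td d) (v : Vd d),
      |tderiv φ s (secT y) + σ * lapl (φ s) (secT y) - dotp v (gradv (φ s) (secT y))|
        ≤ C * (1 + sqnorm v) := by
  obtain ⟨C1, h1, H1⟩ := lv_cpt_bd ((lv_td_cont hφ).add ((lv_la_cont hφ).const_smul σ)) a b
  have : ∀ i, ∃ C : ℝ, 0 ≤ C ∧ ∀ s ∈ Icc a b, ∀ y : Td d, |gradv (φ s) (secT y) i| ≤ C :=
    fun i => lv_cpt_bd (lv_gr_cont hφ i) a b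
  choose C hC HC using this
  set D := ∑ i, C i with hD
  have hD0 : 0 ≤ D := Finset.sum_nonneg fun i _ => hC i
  refine ⟨C1 + D, by positivity, fun s hs y v => ?_⟩
  have e1 : |tderiv φ s (secT y) + σ * lapl (φ s) (secT y)| ≤ C1 := H1 s hs y
  have e2 : |dotp v (gradv (φ s) (secT y))| ≤ D * (1 + sqnorm v) := by
    unfold dotp
    refine (Finset.abs_sum_le_sum_abs _ _).trans ?_
    rw [hD, Finset.sum_mul]
    refine Finset.sum_le_sum fun i _ => ?_
    rw [abs_mul, mul_comm]
    refine mul_le_mul (HC i s hs y) ?_ (abs_nonneg _) (hC i)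
    have : (v i)^2 ≤ sqnorm v :=
      Finset.single_le_sum (f := fun i => (v i)^2) (fun i _ => sq_nonneg _) (Finset.mem_univ i)
    have h3 : |v i| ≤ 1 + (v i)^2 := by
      rw [← sq_abs]; nlinarith [sq_nonneg (|v i| - 1), abs_nonneg (v i)]
    linarith
  have := lv_sq_nonneg v
  calc _ ≤ C1 + D * (1 + sqnorm v) := (abs_sub _ _).trans (add_le_add e1 e2)
    _ ≤ _ := by nlinarith

lemma lv_meas_comp {K : ℝ × Vd d → ℝ} (hK : Continuous K) :
    Measurable (fun q : ℝ × Td d => K (q.1, secT q.2)) :=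
  hK.measurable.comp (measurable_fst.prodMk (lv_secT_meas.comp measurable_snd))

lemma lv_FPG_meas (hφ : ContDiff ℝ 2 (fun q : ℝ × Vd d => φ q.1 q.2)) (σ : ℝ)
    {α : ℝ → Td d → Vd d} (hα : Measurable (fun q : ℝ × Td d => α q.1 q.2)) :
    Measurable (fun q : ℝ × Td d => tderiv φ q.1 (secT q.2) + σ * lapl (φ q.1) (secT q.2)
      - dotp (α q.1 q.2) (gradv (φ q.1) (secT q.2))) := by
  refine ((lv_meas_comp (lv_td_cont hφ)).add ((lv_meas_comp (lv_la_cont hφ)).const_mul σ)).sub ?_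
  unfold dotp
  refine Finset.measurable_sum _ fun i _ => ?_
  exact ((measurable_pi_apply i).comp hα).mul (lv_meas_comp (lv_gr_cont hφ i))

lemma lv_FPint (hφ : IsTestFun φ) (σ : ℝ) {a b : ℝ} (hab : a ≤ b) {m : ℝ → PTd d}
    {α : ℝ → Td d → Vd d} (hm : W1ContOn m (Icc a b))
    (hα : Measurable (fun q : ℝ × Td d => α q.1 q.2))
    (hf : (∫⁻ s in Set.Ioc a b, ∫⁻ y, ENNReal.ofReal (sqnorm (α s y)) ∂(m s : Measure (Td d))) < ⊤) :
    IntervalIntegrable (fun s => ∫ y, (tderiv φ s (secT y) + σ * lapl (φ s) (secT y)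
        - dotp (α s y) (gradv (φ s) (secT y))) ∂(m s : Measure (Td d))) volume a b := by
  rw [intervalIntegrable_iff_integrableOn_Ioc_of_le hab]
  refine ⟨lv_kernel_aesm hab hm (lv_FPG_meas hφ.1 σ hα), ?_⟩
  obtain ⟨C, hC, H⟩ := lv_FPG_bd hφ.1 σ a b
  rw [hasFiniteIntegral_iff_enorm]
  have hb : ∀ s ∈ Ioc a b, ‖∫ y, (tderiv φ s (secT y) + σ * lapl (φ s) (secT y)
        - dotp (α s y) (gradv (φ s) (secT y))) ∂(m s : Measure (Td d))‖ₑ ≤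
      ENNReal.ofReal C * (1 + ∫⁻ y, ENNReal.ofReal (sqnorm (α s y)) ∂(m s : Measure (Td d))) := by
    intro s hs
    refine (enorm_integral_le_lintegral_enorm _).trans ?_
    have : ∀ y, ‖tderiv φ s (secT y) + σ * lapl (φ s) (secT y)
        - dotp (α s y) (gradv (φ s) (secT y))‖ₑ ≤
        ENNReal.ofReal C * (1 + ENNReal.ofReal (sqnorm (α s y))) := by
      intro y
      rw [← ENNReal.ofReal_one, ← ENNReal.ofReal_add zero_le_one (lv_sq_nonneg _),
        ← ENNReal.ofReal_mul hC, ← ofReal_norm]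
      exact ENNReal.ofReal_le_ofReal (H s (Ioc_subset_Icc_self hs) y (α s y))
    refine (lintegral_mono this).trans ?_
    rw [lintegral_const_mul' _ _ ENNReal.ofReal_ne_top, lintegral_add_left measurable_const]
    simp
  refine (setLIntegral_mono' measurableSet_Ioc hb).trans_lt ?_
  rw [lintegral_const_mul' _ _ ENNReal.ofReal_ne_top, lintegral_add_left measurable_const]
  refine ENNReal.mul_lt_top ENNReal.ofReal_lt_top (ENNReal.add_lt_top.2 ⟨?_, hf⟩)
  simp

end tests

section shifts
variable {d : ℕ}

lemma lv_FP_shift {σ : ℝ} {m : ℝ → PTd d} {α : ℝ → Td d → Vd d} {s₁ s₂ : ℝ} (a : ℝ)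
    (h : FPeq σ m α (s₁ + a) (s₂ + a)) :
    FPeq σ (fun t => m (t + a)) (fun t => α (t + a)) s₁ s₂ := by
  intro φ hφ
  have hψ : IsTestFun (fun t x => φ (t - a) x) := by
    refine ⟨?_, fun t x z => hφ.2 _ _ _⟩
    exact hφ.1.comp ((contDiff_fst.sub contDiff_const).prodMk contDiff_snd)
  have := h _ hψ
  simp only [add_sub_cancel_right] at this
  rw [this, ← intervalIntegral.integral_comp_add_right (fun s => ∫ y, (tderiv (fun t x => φ (t - a) x) s (secT y) + σ * lapl (φ (s - a)) (secT y)
        - dotp (α s y) (gradv (φ (s - a)) (secT y))) ∂(m s : Measure (Td d)))]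
  have e : ∀ s x, tderiv (fun t x => φ (t - a) x) (s + a) x = tderiv φ s x := by
    intro s x
    unfold tderiv
    rw [deriv_comp_sub_const (f := fun t => φ t x)]
    simp
  simp only [add_sub_cancel_right, e]

lemma lv_FP_congr {σ : ℝ} {m m' : ℝ → PTd d} {α α' : ℝ → Td d → Vd d} {s₁ s₂ : ℝ} (h12 : s₁ ≤ s₂)
    (h : FPeq σ m α s₁ s₂) (h1 : m' s₁ = m s₁) (h2 : m' s₂ = m s₂)
    (h3 : ∀ s ∈ Ioc s₁ s₂, m' s = m s ∧ α' s = α s) : FPeq σ m' α' s₁ s₂ := by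
  intro φ hφ
  rw [h1, h2, h φ hφ, intervalIntegral.integral_of_le h12, intervalIntegral.integral_of_le h12]
  refine setIntegral_congr_fun measurableSet_Ioc fun s hs => ?_
  simp only [(h3 s hs).1, (h3 s hs).2]

lemma lv_FP_trans {σ : ℝ} {m : ℝ → PTd d} {α : ℝ → Td d → Vd d} {s₁ T s₂ : ℝ} (h1 : s₁ ≤ T)
    (h2 : T ≤ s₂) (hm : W1ContOn m (Icc s₁ s₂))
    (hα : Measurable (fun q : ℝ × Td d => α q.1 q.2))
    (hf : (∫⁻ s in Set.Ioc s₁ s₂, ∫⁻ y, ENNReal.ofReal (sqnorm (α s y)) ∂(m s : Measure (Td d))) < ⊤)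
    (e1 : FPeq σ m α s₁ T) (e2 : FPeq σ m α T s₂) : FPeq σ m α s₁ s₂ := by
  intro φ hφ
  have hi := lv_FPint hφ σ (h1.trans h2) hm hα hf
  rw [← intervalIntegral.integral_add_adjacent_intervals (b := T), ← e1 φ hφ, ← e2 φ hφ]
  · ring
  · exact hi.mono_set (by rw [uIcc_of_le h1, uIcc_of_le (h1.trans h2)]; exact Icc_subset_Icc_right h2)
  · exact hi.mono_set (by rw [uIcc_of_le h2, uIcc_of_le (h1.trans h2)]; exact Icc_subset_Icc_left h1)

lemma lv_W1_glue {m : ℝ → PTd d} {T : ℝ} (h1 : W1ContOn m (Icc 0 T)) (h2 : W1ContOn m (Ici T)) :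
    W1ContOn m (Ici 0) := by
  intro t ht ε hε
  rcases lt_trichotomy t T with h | h | h
  · obtain ⟨η, hη, H⟩ := h1 t ⟨ht, h.le⟩ ε hε
    refine ⟨min η (T - t), lt_min hη (by linarith), fun s hs hst => H s ⟨hs, ?_⟩ (hst.trans_le (min_le_left _ _))⟩
    have := (abs_lt.1 (hst.trans_le (min_le_right _ _))).2
    linarith
  · subst h
    obtain ⟨η, hη, H⟩ := h1 t ⟨ht, le_rfl⟩ ε hε
    obtain ⟨η', hη', H'⟩ := h2 t self_mem_Ici ε hε
    refine ⟨min η η', lt_min hη hη', fun s hs hst => ?_⟩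
    rcases le_total s t with h | h
    · exact H s ⟨hs, h⟩ (hst.trans_le (min_le_left _ _))
    · exact H' s h (hst.trans_le (min_le_right _ _))
  · obtain ⟨η, hη, H⟩ := h2 t h.le ε hε
    refine ⟨min η (t - T), lt_min hη (by linarith), fun s hs hst => H s ?_ (hst.trans_le (min_le_left _ _))⟩
    have := (abs_lt.1 (hst.trans_le (min_le_right _ _))).1
    simp only [mem_Ici]
    linarith

lemma lv_W1_shift {m : ℝ → PTd d} {I J : Set ℝ} (a : ℝ) (h : W1ContOn m I)
    (hJ : ∀ t ∈ J, t + a ∈ I) : W1ContOn (fun t => m (t + a)) J := by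
  intro t ht ε hε
  obtain ⟨η, hη, H⟩ := h (t + a) (hJ t ht) ε hε
  exact ⟨η, hη, fun s hs hst => H (s + a) (hJ s hs) (by simpa using hst)⟩

lemma lv_W1_congr {m m' : ℝ → PTd d} {I : Set ℝ} (h : W1ContOn m I) (he : ∀ t ∈ I, m' t = m t) :
    W1ContOn m' I := by
  intro t ht ε hε
  obtain ⟨η, hη, H⟩ := h t ht ε hε
  refine ⟨η, hη, fun s hs hst => ?_⟩
  rw [he s hs, he t ht]; exact H s hs hst

lemma lv_shift_int (f : ℝ → ℝ) (a : ℝ) :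
    IntegrableOn (fun s => f (s + a)) (Ioi 0) ↔ IntegrableOn f (Ioi a) := by
  have h := (measurePreserving_add_right (volume : Measure ℝ) a).integrableOn_comp_preimage
    (measurableEmbedding_addRight a) (f := f) (s := Ioi a)
  have e : (fun x => x + a) ⁻¹' Ioi a = Ioi (0:ℝ) := by ext x; simp
  rw [e] at h
  exact h

lemma lv_shift_integral (f : ℝ → ℝ) (a : ℝ) :
    ∫ s in Ioi 0, f (s + a) = ∫ s in Ioi a, f s := by
  have h := (measurePreserving_add_right (volume : Measure ℝ) a).setIntegral_preimage_emb
    (measurableEmbedding_addRight a) f (Ioi a)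
  have e : (fun x => x + a) ⁻¹' Ioi a = Ioi (0:ℝ) := by ext x; simp
  rw [e] at h
  exact h

lemma lv_shift_lint (f : ℝ → ENNReal) (a : ℝ) :
    ∫⁻ s in Ioi 0, f (s + a) = ∫⁻ s in Ioi a, f s := by
  have h := (measurePreserving_add_right (volume : Measure ℝ) a).setLIntegral_comp_preimage_emb
    (measurableEmbedding_addRight a) f (Ioi a)
  have e : (fun x => x + a) ⁻¹' Ioi a = Ioi (0:ℝ) := by ext x; simp
  rw [e] at h
  exact h

lemma lv_shift_lint_Ioc (f : ℝ → ENNReal) (a b : ℝ) :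
    ∫⁻ s in Ioc 0 b, f (s + a) = ∫⁻ s in Ioc a (b + a), f s := by
  have h := (measurePreserving_add_right (volume : Measure ℝ) a).setLIntegral_comp_preimage_emb
    (measurableEmbedding_addRight a) f (Ioc a (b + a))
  have e : (fun x => x + a) ⁻¹' Ioc a (b + a) = Ioc (0:ℝ) b := by ext x; simp
  rw [e] at h
  exact h

lemma lv_on_shift (S : MFGSetting d) {σ : ℝ} {μ : PTd d} {T a : ℝ} (ha : 0 ≤ a)
    {m : ℝ → PTd d} {α : ℝ → Td d → Vd d} (h : AdmOn S σ μ T m α) (haT : a ≤ T) :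
    AdmOn S σ (m a) (T - a) (fun t => m (t + a)) (fun t => α (t + a)) := by
  obtain ⟨h0, hW, hF, hM, hL, hI⟩ := h
  refine ⟨by simp, lv_W1_shift a hW ?_, ?_, ?_, ?_, ?_⟩
  · rintro t ⟨h1, h2⟩; exact ⟨by linarith, by linarith⟩
  · intro s₁ s₂ h1 h2 h3
    exact lv_FP_shift a (hF _ _ (by linarith) (by linarith) (by linarith))
  · exact hM.comp ((measurable_fst.add_const a).prodMk measurable_snd)
  · rw [lv_shift_lint_Ioc (fun s => ∫⁻ y, ENNReal.ofReal (sqnorm (α s y)) ∂(m s : Measure (Td d)))]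
    refine (lintegral_mono_set ?_).trans_lt hL
    intro s hs; exact ⟨by linarith [hs.1], by linarith [hs.2]⟩
  · have : IntervalIntegrable (runCost S m α) volume a T :=
      hI.mono_set (by rw [uIcc_of_le haT, uIcc_of_le (ha.trans haT)]; exact Icc_subset_Icc_left ha)
    have := this.comp_add_right (c := a)
    rw [sub_self] at this
    exact this

lemma lv_disc_shift (S : MFGSetting d) {σ δ : ℝ} {μ : PTd d} {a : ℝ} (ha : 0 ≤ a)
    {m : ℝ → PTd d} {α : ℝ → Td d → Vd d} (h : AdmDisc S σ δ μ m α) :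
    AdmDisc S σ δ (m a) (fun t => m (t + a)) (fun t => α (t + a)) := by
  obtain ⟨h0, hW, hF, hM, hL, hI⟩ := h
  refine ⟨by simp, lv_W1_shift a hW ?_, ?_, ?_, ?_, ?_⟩
  · intro t h1; simp only [mem_Ici] at *; linarith
  · intro s₁ s₂ h1 h2
    exact lv_FP_shift a (hF _ _ (by linarith) (by linarith))
  · exact hM.comp ((measurable_fst.add_const a).prodMk measurable_snd)
  · have e : ∀ s, ENNReal.ofReal (Real.exp (-δ * s)) = ENNReal.ofReal (Real.exp (δ * a)) *
        ENNReal.ofReal (Real.exp (-δ * (s + a))) := by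
      intro s
      rw [← ENNReal.ofReal_mul (Real.exp_nonneg _), ← Real.exp_add]
      congr 2; ring
    have e' : ∀ s, ENNReal.ofReal (Real.exp (-δ * s)) *
        ∫⁻ y, ENNReal.ofReal (sqnorm (α (s + a) y)) ∂(m (s + a) : Measure (Td d)) =
        ENNReal.ofReal (Real.exp (δ * a)) * (ENNReal.ofReal (Real.exp (-δ * (s + a))) *
        ∫⁻ y, ENNReal.ofReal (sqnorm (α (s + a) y)) ∂(m (s + a) : Measure (Td d))) := by
      intro s; rw [e s, mul_assoc]
    rw [lintegral_congr e', lintegral_const_mul' _ _ ENNReal.ofReal_ne_top, lv_shift_lint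
      (fun s => ENNReal.ofReal (Real.exp (-δ * s)) *
      ∫⁻ y, ENNReal.ofReal (sqnorm (α s y)) ∂(m s : Measure (Td d)))]
    refine ENNReal.mul_lt_top ENNReal.ofReal_lt_top ((lintegral_mono_set ?_).trans_lt hL)
    exact Ioi_subset_Ioi ha
  · have h1 : IntegrableOn (fun s => Real.exp (-δ * s) * runCost S m α s) (Ioi a) :=
      IntegrableOn.mono_set hI (Ioi_subset_Ioi ha)
    rw [← lv_shift_int] at h1
    have h2 := h1.const_mul (Real.exp (δ * a))
    refine h2.congr (Eventually.of_forall fun s => ?_)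
    simp only
    rw [← mul_assoc, ← Real.exp_add, show δ * a + -δ * (s + a) = -δ * s by ring]
    rfl

lemma lv_exp_int_iff {δ T : ℝ} {L : ℝ → ℝ} :
    IntervalIntegrable (fun s => Real.exp (-δ * s) * L s) volume 0 T ↔ IntervalIntegrable L volume 0 T := by
  constructor
  · intro h
    have := h.continuousOn_mul (g := fun s => Real.exp (δ * s)) (by fun_prop)
    refine this.congr (fun s _ => ?_)
    rw [← mul_assoc, ← Real.exp_add]
    simp
  · intro h
    exact h.continuousOn_mul (g := fun s => Real.exp (-δ * s)) (by fun_prop)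

lemma lv_disc_restrict (S : MFGSetting d) {σ δ : ℝ} (hδ : 0 < δ) {μ : PTd d} {T : ℝ} (hT : 0 ≤ T)
    {m : ℝ → PTd d} {α : ℝ → Td d → Vd d} (h : AdmDisc S σ δ μ m α) : AdmOn S σ μ T m α := by
  obtain ⟨h0, hW, hF, hM, hL, hI⟩ := h
  refine ⟨h0, lv_W1ContOn_mono hW Icc_subset_Ici_self, fun s₁ s₂ h1 h2 _ => hF s₁ s₂ h1 h2, hM, ?_, ?_⟩
  · have : ∀ s ∈ Ioc 0 T, ∫⁻ y, ENNReal.ofReal (sqnorm (α s y)) ∂(m s : Measure (Td d)) ≤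
        ENNReal.ofReal (Real.exp (δ * T)) * (ENNReal.ofReal (Real.exp (-δ * s)) *
        ∫⁻ y, ENNReal.ofReal (sqnorm (α s y)) ∂(m s : Measure (Td d))) := by
      intro s hs
      rw [← mul_assoc, ← ENNReal.ofReal_mul (Real.exp_nonneg _), ← Real.exp_add]
      refine le_mul_of_one_le_left' ?_
      rw [← ENNReal.ofReal_one]
      refine ENNReal.ofReal_le_ofReal (Real.one_le_exp ?_)
      nlinarith [hs.2]
    refine (setLIntegral_mono' measurableSet_Ioc this).trans_lt ?_
    rw [lintegral_const_mul' _ _ ENNReal.ofReal_ne_top]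
    exact ENNReal.mul_lt_top ENNReal.ofReal_lt_top
      ((lintegral_mono_set Ioc_subset_Ioi_self).trans_lt hL)
  · rw [← lv_exp_int_iff (δ := δ), intervalIntegrable_iff_integrableOn_Ioc_of_le hT]
    exact IntegrableOn.mono_set hI Ioc_subset_Ioi_self

lemma lv_disc_split (S : MFGSetting d) {σ δ : ℝ} {μ : PTd d} {a : ℝ} (ha : 0 ≤ a)
    {m : ℝ → PTd d} {α : ℝ → Td d → Vd d} (h : AdmDisc S σ δ μ m α) :
    costDisc S δ m α = (∫ s in (0:ℝ)..a, Real.exp (-δ * s) * runCost S m α s) +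
      Real.exp (-δ * a) * costDisc S δ (fun t => m (t + a)) (fun t => α (t + a)) := by
  have hI : IntegrableOn (fun s => Real.exp (-δ * s) * runCost S m α s) (Ioi 0) := h.2.2.2.2.2
  have e2 : Real.exp (-δ * a) * costDisc S δ (fun t => m (t + a)) (fun t => α (t + a)) =
      ∫ s in Ioi a, Real.exp (-δ * s) * runCost S m α s := by
    rw [← lv_shift_integral]
    unfold costDisc
    rw [← integral_const_mul]
    congr 1
    funext s
    rw [← mul_assoc, ← Real.exp_add, show -δ * a + -δ * s = -δ * (s + a) by ring]
    rfl
  rw [e2, intervalIntegral.integral_of_le ha]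
  unfold costDisc
  rw [← Ioc_union_Ioi_eq_Ioi ha, setIntegral_union Ioc_disjoint_Ioi_same measurableSet_Ioi
    (hI.mono_set Ioc_subset_Ioi_self) (hI.mono_set (Ioi_subset_Ioi ha))]

lemma lv_disc_concat (S : MFGSetting d) {σ δ : ℝ} (hδ : 0 < δ) {μ : PTd d} {T : ℝ} (hT : 0 ≤ T)
    {m m₂ : ℝ → PTd d} {α α₂ : ℝ → Td d → Vd d} (h : AdmOn S σ μ T m α)
    (h' : AdmDisc S σ δ (m T) m₂ α₂) :
    ∃ m' α', AdmDisc S σ δ μ m' α' ∧ costDisc S δ m' α' =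
      (∫ s in (0:ℝ)..T, Real.exp (-δ * s) * runCost S m α s) + Real.exp (-δ * T) * costDisc S δ m₂ α₂ := by
  obtain ⟨h0, hW, hF, hM, hL, hI⟩ := h
  obtain ⟨k0, kW, kF, kM, kL, kI⟩ := h'
  let m' : ℝ → PTd d := fun t => if t ≤ T then m t else m₂ (t - T)
  let α' : ℝ → Td d → Vd d := fun t => if t ≤ T then α t else α₂ (t - T)
  have m1 : ∀ t, t ≤ T → m' t = m t := fun t ht => if_pos ht
  have a1 : ∀ t, t ≤ T → α' t = α t := fun t ht => if_pos ht
  have a2 : ∀ t, T < t → α' t = α₂ (t - T) := fun t ht => if_neg (not_le.2 ht)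
  have m2 : ∀ t, T ≤ t → m' t = m₂ (t - T) := by
    intro t ht
    rcases ht.eq_or_lt with rfl | ht
    · rw [m1 _ le_rfl, sub_self, k0]
    · exact if_neg (not_le.2 ht)
  have hW' : W1ContOn m' (Ici 0) := by
    refine lv_W1_glue (T := T) (lv_W1_congr hW fun t ht => m1 t ht.2) ?_
    refine lv_W1_congr (lv_W1_shift (J := Ici T) (-T) kW ?_) (fun t ht => ?_)
    · intro t ht; simpa using ht
    · rw [m2 t ht]; rfl
  have hM' : Measurable (fun q : ℝ × Td d => α' q.1 q.2) := by
    have : (fun q : ℝ × Td d => α' q.1 q.2) =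
        fun q => if q.1 ≤ T then α q.1 q.2 else α₂ (q.1 - T) q.2 := by
      funext q
      by_cases hq : q.1 ≤ T
      · rw [a1 _ hq, if_pos hq]
      · rw [a2 _ (not_le.1 hq), if_neg hq]
    rw [this]
    refine Measurable.ite (measurableSet_le measurable_fst measurable_const) hM ?_
    exact kM.comp ((measurable_fst.sub_const T).prodMk measurable_snd)
  have hL' : (∫⁻ s in Set.Ioi (0:ℝ), ENNReal.ofReal (Real.exp (-δ * s)) *
      ∫⁻ y, ENNReal.ofReal (sqnorm (α' s y)) ∂(m' s : Measure (Td d))) < ⊤ := by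
    rw [← Ioc_union_Ioi_eq_Ioi hT, lintegral_union measurableSet_Ioi Ioc_disjoint_Ioi_same]
    refine ENNReal.add_lt_top.2 ⟨?_, ?_⟩
    · refine lt_of_le_of_lt (setLIntegral_mono' measurableSet_Ioc
        (g := fun s => ∫⁻ y, ENNReal.ofReal (sqnorm (α s y)) ∂(m s : Measure (Td d))) fun s hs => ?_) hL
      rw [a1 s hs.2, m1 s hs.2]
      refine mul_le_of_le_one_left' ?_
      rw [← ENNReal.ofReal_one]
      refine ENNReal.ofReal_le_ofReal (Real.exp_le_one_iff.2 ?_)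
      nlinarith [hs.1]
    · rw [← lv_shift_lint]
      refine lt_of_le_of_lt (setLIntegral_mono' measurableSet_Ioi
        (g := fun s => ENNReal.ofReal (Real.exp (-δ * s)) *
          ∫⁻ y, ENNReal.ofReal (sqnorm (α₂ s y)) ∂(m₂ s : Measure (Td d))) fun s hs => ?_) kL
      have hs' : T < s + T := by simp only [mem_Ioi] at hs; linarith
      rw [a2 _ hs', m2 _ hs'.le, add_sub_cancel_right]
      refine mul_le_mul_left (ENNReal.ofReal_le_ofReal (Real.exp_le_exp.2 ?_)) _
      nlinarith
  have r1 : ∀ s, s ≤ T → runCost S m' α' s = runCost S m α s := by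
    intro s hs; unfold runCost; rw [a1 s hs, m1 s hs]
  have r2 : ∀ s, T < s → runCost S m' α' s = runCost S m₂ α₂ (s - T) := by
    intro s hs; unfold runCost; rw [a2 s hs, m2 s hs.le]
  have hI' : Integrable (fun s => Real.exp (-δ * s) * runCost S m' α' s)
      (volume.restrict (Set.Ioi 0)) := by
    change IntegrableOn _ _ volume
    rw [← Ioc_union_Ioi_eq_Ioi hT]
    refine IntegrableOn.union ?_ ?_
    · have := (lv_exp_int_iff (δ := δ)).2 hI
      rw [intervalIntegrable_iff_integrableOn_Ioc_of_le hT] at this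
      refine this.congr_fun (fun s hs => ?_) measurableSet_Ioc
      simp only; rw [r1 s hs.2]
    · rw [← lv_shift_int]
      have := kI.const_mul (Real.exp (-δ * T))
      refine IntegrableOn.congr_fun this (fun s hs => ?_) measurableSet_Ioi
      simp only [mem_Ioi] at hs
      rw [r2 _ (by linarith), add_sub_cancel_right, ← mul_assoc, ← Real.exp_add]
      congr 2; ring
  have hadmpre : ∀ b, 0 ≤ b → (∫⁻ s in Set.Ioc (0:ℝ) b, ∫⁻ y, ENNReal.ofReal (sqnorm (α' s y)) ∂(m' s : Measure (Td d))) < ⊤ := by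
    intro b hb
    have : ∀ s ∈ Ioc 0 b, ∫⁻ y, ENNReal.ofReal (sqnorm (α' s y)) ∂(m' s : Measure (Td d)) ≤
        ENNReal.ofReal (Real.exp (δ * b)) * (ENNReal.ofReal (Real.exp (-δ * s)) *
        ∫⁻ y, ENNReal.ofReal (sqnorm (α' s y)) ∂(m' s : Measure (Td d))) := by
      intro s hs
      rw [← mul_assoc, ← ENNReal.ofReal_mul (Real.exp_nonneg _), ← Real.exp_add]
      refine le_mul_of_one_le_left' ?_
      rw [← ENNReal.ofReal_one]
      refine ENNReal.ofReal_le_ofReal (Real.one_le_exp ?_)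
      nlinarith [hs.2]
    refine (setLIntegral_mono' measurableSet_Ioc this).trans_lt ?_
    rw [lintegral_const_mul' _ _ ENNReal.ofReal_ne_top]
    exact ENNReal.mul_lt_top ENNReal.ofReal_lt_top
      ((lintegral_mono_set Ioc_subset_Ioi_self).trans_lt hL')
  have f1 : ∀ s₁ s₂ : ℝ, 0 ≤ s₁ → s₁ ≤ s₂ → s₂ ≤ T → FPeq σ m' α' s₁ s₂ := by
    intro s₁ s₂ i1 i2 i3
    exact lv_FP_congr i2 (hF s₁ s₂ i1 i2 i3) (m1 _ (i2.trans i3)) (m1 _ i3)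
      (fun s hs => ⟨m1 s (hs.2.trans i3), a1 s (hs.2.trans i3)⟩)
  have f2 : ∀ s₁ s₂ : ℝ, T ≤ s₁ → s₁ ≤ s₂ → FPeq σ m' α' s₁ s₂ := by
    intro s₁ s₂ i1 i2
    have := lv_FP_shift (m := m₂) (α := α₂) (σ := σ) (s₁ := s₁) (s₂ := s₂) (-T) (kF _ _ (by linarith) (by linarith))
    exact lv_FP_congr i2 this (m2 _ i1) (m2 _ (i1.trans i2))
      (fun s hs => ⟨m2 s (i1.trans hs.1.le), a2 s (i1.trans_lt hs.1)⟩)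
  have hA : AdmDisc S σ δ μ m' α' := by
    refine ⟨(m1 0 hT).trans h0, hW', ?_, hM', hL', hI'⟩
    intro s₁ s₂ i1 i2
    rcases le_total s₂ T with i3 | i3
    · exact f1 _ _ i1 i2 i3
    rcases le_total T s₁ with i4 | i4
    · exact f2 _ _ i4 i2
    refine lv_FP_trans i4 i3 (lv_W1ContOn_mono hW' fun t ht => i1.trans ht.1) hM' ?_
      (f1 _ _ i1 i4 le_rfl) (f2 _ _ le_rfl i3)
    exact (lintegral_mono_set (Ioc_subset_Ioc_left i1)).trans_lt (hadmpre s₂ (i1.trans i2))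
  refine ⟨m', α', hA, ?_⟩
  rw [lv_disc_split S hT hA]
  congr 1
  · rw [intervalIntegral.integral_of_le hT, intervalIntegral.integral_of_le hT]
    refine setIntegral_congr_fun measurableSet_Ioc fun s hs => ?_
    rw [r1 s hs.2]
  · congr 1
    unfold costDisc
    refine setIntegral_congr_fun measurableSet_Ioi fun s hs => ?_
    simp only [mem_Ioi] at hs
    have : runCost S (fun t => m' (t + T)) (fun t => α' (t + T)) s = runCost S m' α' (s + T) := rfl
    rw [this, r2 _ (by linarith), add_sub_cancel_right]
end shifts

/-- Gaussian density -/
def lvg {d : ℕ} (z : Vd d) : ℝ := ∏ i, ProbabilityTheory.gaussianPDFReal 0 1 (z i)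

/-- Gaussian measure -/
def lvγ (d : ℕ) : Measure (Vd d) := volume.withDensity (fun z => ENNReal.ofReal (lvg z))

section gauss
variable {d : ℕ}

lemma lvg_nonneg (z : Vd d) : 0 ≤ lvg z :=
  Finset.prod_nonneg fun _ _ => ProbabilityTheory.gaussianPDFReal_nonneg _ _ _

lemma lvg_eq (z : Vd d) : lvg z = (∏ _i : Fin d, (√(2 * Real.pi))⁻¹) * Real.exp (-(∑ i, (z i)^2) / 2) := by
  unfold lvg ProbabilityTheory.gaussianPDFReal
  rw [Finset.prod_mul_distrib, ← Real.exp_sum, ← Finset.sum_div, Finset.sum_neg_distrib]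
  simp

lemma lvg_fderiv (z : Vd d) (i : Fin d) :
    DifferentiableAt ℝ (lvg : Vd d → ℝ) z ∧ fderiv ℝ (lvg : Vd d → ℝ) z (Pi.single i 1) = - z i * lvg z := by
  have e : (lvg : Vd d → ℝ) = fun z => (∏ _i : Fin d, (√(2 * Real.pi))⁻¹) * Real.exp (-(∑ i, (z i)^2) / 2) :=
    funext lvg_eq
  have hd : ∀ z, DifferentiableAt ℝ (lvg : Vd d → ℝ) z := by rw [e]; intro z; fun_prop
  refine ⟨hd z, ?_⟩
  have h1 := (hd z).lineDeriv_eq_fderiv (v := Pi.single i 1)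
  rw [← h1]
  have h2 : HasDerivAt (fun t : ℝ => lvg (z + t • Pi.single i (1:ℝ))) (- z i * lvg z) 0 := by
    have e2 : (fun t : ℝ => lvg (z + t • Pi.single i (1:ℝ))) =
        fun t => lvg z * Real.exp (-(z i) * t - t^2/2) := by
      funext t
      rw [lvg_eq, lvg_eq, mul_assoc, ← Real.exp_add]
      congr 2
      have : ∀ j, ((z + t • Pi.single i (1:ℝ) : Vd d) j)^2 = (z j)^2 + (if j = i then 2 * z i * t + t^2 else 0) := by
        intro j
        by_cases h : j = i
        · subst h; simp; ring
        · simp [h]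
      simp_rw [this, Finset.sum_add_distrib]
      simp
      ring
    rw [e2]
    have h3 : HasDerivAt (fun t : ℝ => -(z i) * t - t^2/2) (-(z i) * 1 - (2 * 0)/2) 0 := by
      have h4 : HasDerivAt (fun t : ℝ => t^2) (2 * 0) (0:ℝ) := by
        simpa using hasDerivAt_pow 2 (0:ℝ)
      exact ((hasDerivAt_id' (0:ℝ)).const_mul (-(z i))).fun_sub (h4.div_const 2)
    have h5 := h3.exp.const_mul (lvg z)
    refine h5.congr_deriv ?_
    norm_num
    ring
  exact h2.deriv

lemma lvg_int : Integrable (lvg : Vd d → ℝ) :=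
  Integrable.fintype_prod (f := fun _ : Fin d => ProbabilityTheory.gaussianPDFReal 0 1)
    (fun _ => ProbabilityTheory.integrable_gaussianPDFReal 0 1)

lemma lvg_meas : Measurable (lvg : Vd d → ℝ) := by
  unfold lvg
  refine Finset.measurable_prod _ fun i _ => ?_
  exact (ProbabilityTheory.measurable_gaussianPDFReal 0 1).comp (measurable_pi_apply i)

lemma lvg_integral : ∫ z, (lvg z : ℝ) ∂(volume : Measure (Vd d)) = 1 := by
  unfold lvg
  rw [integral_fintype_prod_volume_eq_prod (fun _ : Fin d => ProbabilityTheory.gaussianPDFReal 0 1)]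
  simp [ProbabilityTheory.integral_gaussianPDFReal_eq_one]

instance lvγ_prob : IsProbabilityMeasure (lvγ d) := by
  constructor
  unfold lvγ
  rw [withDensity_apply _ MeasurableSet.univ, Measure.restrict_univ,
    ← ofReal_integral_eq_lintegral_ofReal lvg_int (Eventually.of_forall lvg_nonneg), lvg_integral]
  simp

lemma lv_x_pdf_int : Integrable (fun x : ℝ => x * ProbabilityTheory.gaussianPDFReal 0 1 x) := by
  have := integrable_mul_exp_neg_mul_sq (b := 1/2) (by norm_num)
  have := this.mul_const ((√(2 * Real.pi))⁻¹)
  refine this.congr (Eventually.of_forall fun x => ?_)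
  simp only [ProbabilityTheory.gaussianPDFReal]
  simp
  ring_nf

lemma lv_zi_int_vol (i : Fin d) : Integrable (fun z : Vd d => z i * lvg z) := by
  have := Integrable.fintype_prod (f := fun j : Fin d => fun x : ℝ =>
    (if j = i then x else 1) * ProbabilityTheory.gaussianPDFReal 0 1 x) (μ := fun _ => volume) (by
      intro j
      by_cases h : j = i
      · simpa [h] using lv_x_pdf_int
      · simpa [h] using ProbabilityTheory.integrable_gaussianPDFReal 0 1)
  refine this.congr (Eventually.of_forall fun z => ?_)
  simp only [Finset.prod_mul_distrib, lvg]
  simp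

lemma lvγ_integrable_iff {f : Vd d → ℝ} :
    Integrable f (lvγ d) ↔ Integrable (fun z => f z * lvg z) := by
  unfold lvγ
  rw [integrable_withDensity_iff lvg_meas.ennreal_ofReal (Eventually.of_forall fun z => ENNReal.ofReal_lt_top)]
  simp_rw [ENNReal.toReal_ofReal (lvg_nonneg _)]

lemma lvγ_integral (f : Vd d → ℝ) : ∫ z, f z ∂(lvγ d) = ∫ z, f z * lvg z := by
  unfold lvγ
  rw [integral_withDensity_eq_integral_toReal_smul lvg_meas.ennreal_ofReal (Eventually.of_forall fun z => ENNReal.ofReal_lt_top)]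
  simp_rw [ENNReal.toReal_ofReal (lvg_nonneg _), smul_eq_mul, mul_comm]

lemma lv_zi_int (i : Fin d) : Integrable (fun z : Vd d => z i) (lvγ d) :=
  lvγ_integrable_iff.2 (lv_zi_int_vol i)

lemma lv_stein {ψ : Vd d → ℝ} (hψ : ContDiff ℝ 1 ψ) (i : Fin d) {C D : ℝ} (hC : ∀ z, |ψ z| ≤ C)
    (hD : ∀ z, |fderiv ℝ ψ z (Pi.single i 1)| ≤ D) :
    ∫ z, z i * ψ z ∂(lvγ d) = ∫ z, fderiv ℝ ψ z (Pi.single i 1) ∂(lvγ d) := by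
  have c1 : Continuous (fun z => fderiv ℝ ψ z (Pi.single i 1)) :=
    (hψ.continuous_fderiv (by norm_num)).clm_apply continuous_const
  have i1 : Integrable (fun z => ψ z * (z i * lvg z)) :=
    (lv_zi_int_vol i).bdd_mul hψ.continuous.aestronglyMeasurable (Eventually.of_forall hC)
  have i2 : Integrable (fun z => fderiv ℝ ψ z (Pi.single i 1) * lvg z) :=
    lvg_int.bdd_mul c1.aestronglyMeasurable (Eventually.of_forall hD)
  have i3 : Integrable (fun z => ψ z * lvg z) :=
    lvg_int.bdd_mul hψ.continuous.aestronglyMeasurable (Eventually.of_forall hC)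
  have e : ∀ z, fderiv ℝ (lvg : Vd d → ℝ) z (Pi.single i 1) = - z i * lvg z := fun z => (lvg_fderiv z i).2
  have := integral_mul_fderiv_eq_neg_fderiv_mul_of_integrable (f := ψ) (g := lvg) (v := Pi.single i 1)
    (μ := volume) i2 (by
      refine i1.neg.congr (Eventually.of_forall fun z => ?_)
      simp only [Pi.neg_apply]
      rw [e]; ring) i3 (fun x _ => hψ.differentiable (by norm_num) x) (fun x _ => (lvg_fderiv x i).1)
  rw [lvγ_integral, lvγ_integral, ← neg_eq_iff_eq_neg.2 this, ← integral_neg]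
  congr 1
  funext z
  rw [e]; ring

end gauss

section heat
variable {d : ℕ}

lemma lv_heat_cont (t : ℝ) : Continuous (fun q : Td d × Vd d => q.1 + lvproj (√(2*t) • q.2)) :=
  continuous_fst.add (lv_proj_lip.continuous.comp
    (show Continuous (fun q : Td d × Vd d => √(2*t) • q.2) from by fun_prop))

/-- the heat flow -/
def lvheat (μ : PTd d) (t : ℝ) : PTd d :=
  ⟨Measure.map (fun q : Td d × Vd d => q.1 + lvproj (√(2*t) • q.2)) ((μ : Measure (Td d)).prod (lvγ d)),
    Measure.isProbabilityMeasure_map (lv_heat_cont t).measurable.aemeasurable⟩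

lemma lv_heat_int (μ : PTd d) (t : ℝ) {f : Vd d → ℝ} (hf : Measurable f)
    (hp : ∀ x z, f (x + intVec z) = f x) :
    ∫ y, f (secT y) ∂(lvheat μ t : Measure (Td d)) =
      ∫ q, f (secT q.1 + √(2*t) • q.2) ∂((μ : Measure (Td d)).prod (lvγ d)) := by
  change ∫ y, f (secT y) ∂(Measure.map _ _) = _
  rw [integral_map (lv_heat_cont t).measurable.aemeasurable
    (show AEStronglyMeasurable (fun y => f (secT y)) _ from (hf.comp lv_secT_meas).aestronglyMeasurable)]
  congr 1
  funext q
  exact lv_per hp _ _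

lemma lv_heat_zero (μ : PTd d) : lvheat μ 0 = μ := by
  apply Subtype.ext
  change Measure.map _ _ = (μ : Measure (Td d))
  have : (fun q : Td d × Vd d => q.1 + lvproj (√(2*0) • q.2)) = Prod.fst := by
    funext q
    have : lvproj (0 : Vd d) = 0 := by
      have := lv_proj_add (0 : Vd d) 0
      simpa using this
    simp [this]
  rw [this, Measure.map_fst_prod]
  simp

lemma lv_norm_le_sum (z : Vd d) : ‖z‖ ≤ ∑ i, |z i| := by
  refine (pi_norm_le_iff_of_nonneg (Finset.sum_nonneg fun i _ => abs_nonneg _)).2 fun i => ?_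
  exact Finset.single_le_sum (f := fun i => |z i|) (fun i _ => abs_nonneg _) (Finset.mem_univ i)

lemma lv_z_prod (μ : PTd d) (i : Fin d) :
    Integrable (fun q : Td d × Vd d => |q.2 i|) ((μ : Measure (Td d)).prod (lvγ d)) :=
  (lv_zi_int i).abs.comp_snd _

/-- first moment -/
def lvE (μ : PTd d) : ℝ := ∫ q, ∑ i, |q.2 i| ∂((μ : Measure (Td d)).prod (lvγ d))

lemma lvE_nonneg (μ : PTd d) : 0 ≤ lvE μ :=
  integral_nonneg fun q => Finset.sum_nonneg fun i _ => abs_nonneg _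

lemma lv_heat_diff (μ : PTd d) (s t : ℝ) {f : Vd d → ℝ} (hf : Continuous f)
    (hp : ∀ x z, f (x + intVec z) = f x) {C K : ℝ} (hC : ∀ x, |f x| ≤ C) (hK0 : 0 ≤ K)
    (hK : ∀ x y, |f x - f y| ≤ K * ‖x - y‖) :
    |(∫ y, f (secT y) ∂(lvheat μ s : Measure (Td d))) - ∫ y, f (secT y) ∂(lvheat μ t : Measure (Td d))|
      ≤ K * |√(2*s) - √(2*t)| * lvE μ := by
  rw [lv_heat_int μ s hf.measurable hp, lv_heat_int μ t hf.measurable hp]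
  have hi : ∀ t : ℝ, Integrable (fun q : Td d × Vd d => f (secT q.1 + √(2*t) • q.2))
      ((μ : Measure (Td d)).prod (lvγ d)) := by
    intro t
    refine Integrable.of_bound (C := C) ?_ (Eventually.of_forall fun q => hC _)
    refine Measurable.aestronglyMeasurable ?_
    exact hf.measurable.comp ((lv_secT_meas.comp measurable_fst).add
      (show Measurable (fun q : Td d × Vd d => √(2*t) • q.2) from by fun_prop))
  rw [← integral_sub (hi s) (hi t)]
  unfold lvE
  rw [← integral_const_mul, ← Real.norm_eq_abs]
  refine norm_integral_le_of_norm_le ?_ (Eventually.of_forall fun q => ?_)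
  · exact (integrable_finsetSum _ fun i _ => lv_z_prod μ i).const_mul _
  · rw [Real.norm_eq_abs]
    refine (hK _ _).trans ?_
    rw [add_sub_add_left_eq_sub, ← sub_smul, norm_smul, mul_assoc, Real.norm_eq_abs]
    gcongr
    exact lv_norm_le_sum _

lemma lv_sqrt_tendsto (t : ℝ) (A : ℝ) : ∀ ε > 0, ∃ η > 0, ∀ s, |s - t| < η →
    |√(2*s) - √(2*t)| * A < ε := by
  intro ε hε
  have : ContinuousAt (fun s : ℝ => |√(2*s) - √(2*t)| * A) t := by fun_prop
  have h := Metric.continuousAt_iff.1 this ε hε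
  obtain ⟨η, h1, h2⟩ := h
  refine ⟨η, h1, fun s hs => ?_⟩
  have := h2 (x := s) (by rwa [Real.dist_eq])
  simp only [sub_self, abs_zero, zero_mul, Real.dist_eq, sub_zero] at this
  exact (le_abs_self _).trans_lt this

lemma lv_heat_W1 (μ : PTd d) (s t : ℝ) : W1 (lvheat μ s) (lvheat μ t) ≤ |√(2*s) - √(2*t)| * lvE μ := by
  unfold W1
  refine csSup_le ⟨_, fun _ => 0, LipschitzWith.const' 0, rfl⟩ ?_
  rintro r ⟨φ, hφ, rfl⟩
  obtain ⟨C, hC⟩ := isCompact_univ.exists_bound_of_continuousOn hφ.continuous.continuousOn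
  have h := lv_heat_diff μ s t (f := fun x => φ (lvproj x)) (C := C) (K := 1)
    (hφ.continuous.comp lv_proj_lip.continuous) (by
      intro x z
      have : lvproj (intVec z) = (0 : Td d) := by
        funext i
        simp [lvproj, intVec]
      simp [lv_proj_add, this]) (fun x => hC _ (mem_univ _)) zero_le_one (by
      intro x y
      have := (hφ.comp lv_proj_lip).dist_le_mul x y
      simpa [Real.dist_eq, dist_eq_norm] using this)
  simp only [lv_proj_secT, one_mul] at h
  exact (le_abs_self _).trans h

lemma lv_heat_W1cont (μ : PTd d) (I : Set ℝ) : W1ContOn (lvheat μ) I := by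
  intro t _ ε hε
  obtain ⟨η, h1, h2⟩ := lv_sqrt_tendsto t (lvE μ) ε hε
  exact ⟨η, h1, fun s _ hs => (lv_heat_W1 μ s t).trans_lt (h2 s hs)⟩

lemma lv_Fd_lip {g : Vd d → ℝ} (hg : ContDiff ℝ 2 g) (hp : ∀ x z, g (x + intVec z) = g x) {CF : ℝ}
    (hD : ∀ x v w : Vd d, |D2 g x v w| ≤ CF * ‖v‖ * ‖w‖) (x y : Vd d) :
    |g x - g y| ≤ (d * |CF|) * ‖x - y‖ := by
  have hgd : Differentiable ℝ g := hg.differentiable (by norm_num)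
  have h1 : ∀ i : Fin d, ∀ x, |fderiv ℝ g x (Pi.single i 1)| ≤ |CF| := by
    intro i x
    have hd : ∀ s : ℝ, HasDerivAt (fun s : ℝ => g (x + s • Pi.single i (1:ℝ)))
        (fderiv ℝ g (x + s • Pi.single i (1:ℝ)) (Pi.single i 1)) s := by
      intro s
      have h := ((hasDerivAt_id s).smul_const (Pi.single i (1:ℝ) : Vd d)).const_add x
      have h' := (hgd _).hasFDerivAt.comp_hasDerivAt s h
      rw [one_smul] at h'
      exact h'
    obtain ⟨ξ, hξ, h0⟩ := exists_hasDerivAt_eq_zero (f := fun s : ℝ => g (x + s • Pi.single i (1:ℝ)))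
      (f' := fun s => fderiv ℝ g (x + s • Pi.single i (1:ℝ)) (Pi.single i 1)) (a := 0) (b := 1)
      one_pos (fun s _ => (hd s).continuousAt.continuousWithinAt) (by
        have : (Pi.single i (1:ℝ) : Vd d) = intVec (Pi.single i 1) := by
          funext j; by_cases h : j = i
          · subst h; simp [intVec]
          · simp [intVec, h]
        simp only [zero_smul, add_zero, one_smul]
        rw [this, hp]) (fun s _ => hd s)
    have hG : Differentiable ℝ (fun y => fderiv ℝ g y (Pi.single i 1)) :=
      ((hg.fderiv_right (m := 1) (by norm_num)).clm_apply contDiff_const).differentiable (by norm_num)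
    have hb : ∀ y, ‖fderiv ℝ (fun y => fderiv ℝ g y (Pi.single i 1)) y‖ ≤ |CF| := by
      intro y
      refine ContinuousLinearMap.opNorm_le_bound _ (abs_nonneg _) fun w => ?_
      refine (hD y (Pi.single i 1) w).trans ?_
      rw [Pi.norm_single]
      simp only [norm_one, mul_one]
      gcongr
      exact le_abs_self _
    have h2 := convex_univ.norm_image_sub_le_of_norm_fderiv_le (fun y _ => hG y) (fun y _ => hb y)
      (mem_univ (x + ξ • Pi.single i (1:ℝ))) (mem_univ x)
    rw [h0, sub_zero] at h2
    refine h2.trans ?_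
    have : ‖x - (x + ξ • (Pi.single i (1:ℝ) : Vd d))‖ ≤ 1 := by
      rw [sub_add_cancel_left, norm_neg, norm_smul, Pi.norm_single, norm_one, mul_one,
        Real.norm_eq_abs, abs_le]
      constructor <;> linarith [hξ.1, hξ.2]
    exact mul_le_of_le_one_right (abs_nonneg _) this
  have h3 : ∀ x, ‖fderiv ℝ g x‖ ≤ d * |CF| := by
    intro x
    refine ContinuousLinearMap.opNorm_le_bound _ (by positivity) fun v => ?_
    conv_lhs => rw [pi_eq_sum_univ' v]
    rw [map_sum]
    calc _ ≤ ∑ i : Fin d, ‖v‖ * |CF| := by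
          refine norm_sum_le_of_le _ fun i _ => ?_
          rw [map_smul, norm_smul]
          gcongr
          · exact norm_le_pi_norm v i
          · have := h1 i x
            exact this
      _ = _ := by simp; ring
  have := convex_univ.norm_image_sub_le_of_norm_fderiv_le (fun y _ => hgd y) (fun y _ => h3 y)
      (mem_univ y) (mem_univ x)
  exact this

lemma lv_line_prob (μ ν : PTd d) {t : ℝ} (ht : t ∈ Icc (0:ℝ) 1) : IsProbabilityMeasure (lineComb t μ ν) := by
  constructor
  unfold lineComb
  simp only [Measure.add_apply, Measure.smul_apply, measure_univ, smul_eq_mul, mul_one]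
  rw [← ENNReal.ofReal_add (by linarith [ht.2]) ht.1]
  simp

lemma lv_heat_Fc (S : MFGSetting d) (μ : PTd d) (s t : ℝ) :
    |S.Fc (lvheat μ s) - S.Fc (lvheat μ t)| ≤ |√(2*s) - √(2*t)| * (d * |S.CF| * lvE μ) := by
  rw [S.flat_deriv]
  have := norm_setIntegral_le_of_norm_le_const (μ := volume) (s := Icc (0:ℝ) 1)
    (C := |√(2*s) - √(2*t)| * (d * |S.CF| * lvE μ))
    (f := fun r => ((∫ y, S.Fd (lineComb r (lvheat μ t) (lvheat μ s)) (secT y) ∂(lvheat μ s : Measure (Td d))) -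
        ∫ y, S.Fd (lineComb r (lvheat μ t) (lvheat μ s)) (secT y) ∂(lvheat μ t : Measure (Td d))))
    (by simp) (fun r hr => by
      have hP := lv_line_prob (lvheat μ t) (lvheat μ s) hr
      obtain ⟨M, hM⟩ := S.Fd_bounded
      have := lv_heat_diff μ s t (f := S.Fd (lineComb r (lvheat μ t) (lvheat μ s))) (C := M) (K := d * |S.CF|)
        (S.Fd_smooth _ hP).continuous (S.Fd_per _)
        (hM ⟨_, hP⟩) (by positivity)
        (lv_Fd_lip (S.Fd_smooth _ hP) (S.Fd_per _) (S.Fd_D2_bound _ hP))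
      rw [Real.norm_eq_abs]
      refine this.trans (le_of_eq (by ring)))
  rw [Real.norm_eq_abs] at this
  refine this.trans ?_
  simp [Measure.real]

lemma lv_heat_Fc_cont (S : MFGSetting d) (μ : PTd d) : Continuous (fun s => S.Fc (lvheat μ s)) := by
  rw [Metric.continuous_iff]
  intro t ε hε
  obtain ⟨η, h1, h2⟩ := lv_sqrt_tendsto t (d * |S.CF| * lvE μ) ε hε
  refine ⟨η, h1, fun s hs => ?_⟩
  rw [Real.dist_eq] at hs ⊢
  exact (lv_heat_Fc S μ s t).trans_lt (h2 s hs)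
end heat

section heatFP
variable {d : ℕ}

lemma lv_per_bd {K : ℝ × Vd d → ℝ} (hK : Continuous K)
    (hp : ∀ t x z, K (t, x + intVec z) = K (t, x)) (a b : ℝ) :
    ∃ C : ℝ, 0 ≤ C ∧ ∀ s ∈ Icc a b, ∀ x : Vd d, |K (s, x)| ≤ C := by
  obtain ⟨C, h0, h1⟩ := lv_cpt_bd hK a b
  refine ⟨C, h0, fun s hs x => ?_⟩
  have := lv_per (f := fun x => K (s, x)) (hp s) 0 x
  obtain ⟨z, hz⟩ := lv_eq_of_proj (v := x) (w := secT (lvproj x)) (by rw [lv_proj_secT])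
  rw [hz, hp]
  exact h1 s hs _

lemma lv_fd_per {g : Vd d → ℝ} (hp : ∀ x z, g (x + intVec z) = g x) (x : Vd d) (z : Fin d → ℤ) :
    fderiv ℝ g (x + intVec z) = fderiv ℝ g x := by
  rw [← fderiv_comp_add_right]
  congr 1
  funext y
  exact hp y z

variable {φ : ℝ → Vd d → ℝ}

lemma lv_td_per (hφ : IsTestFun φ) (t : ℝ) (x : Vd d) (z : Fin d → ℤ) :
    tderiv φ t (x + intVec z) = tderiv φ t x := by
  unfold tderiv
  simp_rw [hφ.2]

lemma lv_gr_per (hφ : IsTestFun φ) (t : ℝ) (x : Vd d) (z : Fin d → ℤ) (i : Fin d) :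
    gradv (φ t) (x + intVec z) i = gradv (φ t) x i := by
  unfold gradv
  rw [lv_fd_per (hφ.2 t)]

lemma lv_D2_per (hφ : IsTestFun φ) (t : ℝ) (x : Vd d) (z : Fin d → ℤ) (v w : Vd d) :
    D2 (φ t) (x + intVec z) v w = D2 (φ t) x v w := by
  unfold D2
  rw [lv_fd_per]
  intro x z
  rw [lv_fd_per (hφ.2 t)]

lemma lv_D2_cont (hφ : IsTestFun φ) (v w : Vd d) : Continuous (fun q : ℝ × Vd d => D2 (φ q.1) q.2 v w) := by
  simp_rw [lv_D2_eq hφ.1]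
  exact ((lv_fd_C1 hφ.1 _).continuous_fderiv (by norm_num)).clm_apply continuous_const

/-- the moving point -/
def lvX (t : ℝ) (q : Td d × Vd d) : Vd d := secT q.1 + √(2*t) • q.2

lemma lvX_meas (t : ℝ) : Measurable (lvX t : Td d × Vd d → Vd d) :=
  (lv_secT_meas.comp measurable_fst).add
      (show Measurable (fun q : Td d × Vd d => √(2*t) • q.2) from by fun_prop)

lemma lv_comp_int (μ : PTd d) {K : ℝ × Vd d → ℝ} (hK : Continuous K)
    (hp : ∀ t x z, K (t, x + intVec z) = K (t, x)) (t : ℝ) :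
    Integrable (fun q => K (t, lvX t q)) ((μ : Measure (Td d)).prod (lvγ d)) := by
  obtain ⟨C, h0, h1⟩ := lv_per_bd hK hp t t
  refine Integrable.of_bound (C := C) ?_ (Eventually.of_forall fun q => h1 t ⟨le_rfl, le_rfl⟩ _)
  exact (hK.measurable.comp (measurable_const.prodMk (lvX_meas t))).aestronglyMeasurable

lemma lv_z_comp_int (μ : PTd d) {K : ℝ × Vd d → ℝ} (hK : Continuous K)
    (hp : ∀ t x z, K (t, x + intVec z) = K (t, x)) (t : ℝ) (i : Fin d) :
    Integrable (fun q => q.2 i * K (t, lvX t q)) ((μ : Measure (Td d)).prod (lvγ d)) := by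
  obtain ⟨C, h0, h1⟩ := lv_per_bd hK hp t t
  refine Integrable.mul_bdd (c := C) ((lv_zi_int i).comp_snd _) ?_ (Eventually.of_forall fun q => h1 t ⟨le_rfl, le_rfl⟩ _)
  exact (hK.measurable.comp (measurable_const.prodMk (lvX_meas t))).aestronglyMeasurable

lemma lv_stein_heat (hφ : IsTestFun φ) (μ : PTd d) {t : ℝ} (i : Fin d) :
    ∫ q, q.2 i * gradv (φ t) (lvX t q) i ∂((μ : Measure (Td d)).prod (lvγ d)) =
      √(2*t) * ∫ q, D2 (φ t) (lvX t q) (Pi.single i 1) (Pi.single i 1) ∂((μ : Measure (Td d)).prod (lvγ d)) := by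
  have hgp : ∀ t x z, gradv (φ t) (x + intVec z) i = gradv (φ t) x i := fun t x z => lv_gr_per hφ t x z i
  have hdp := fun t x z => lv_D2_per hφ t x z (Pi.single i 1) (Pi.single i 1)
  rw [integral_prod _ (lv_z_comp_int μ (lv_gr_cont hφ.1 i) hgp t i),
    integral_prod _ (lv_comp_int μ (lv_D2_cont hφ (Pi.single i 1) (Pi.single i 1)) hdp t),
    ← integral_const_mul]
  congr 1
  funext y
  rw [← integral_const_mul]
  obtain ⟨C, h0, h1⟩ := lv_per_bd (lv_gr_cont hφ.1 i) hgp t t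
  obtain ⟨D, h2, h3⟩ := lv_per_bd (lv_D2_cont hφ (Pi.single i 1) (Pi.single i 1)) hdp t t
  have hG : ContDiff ℝ 1 (fun x => gradv (φ t) x i) := by
    unfold gradv
    simp_rw [lv_grad_eq hφ.1]
    exact (lv_fd_C1 hφ.1 _).comp (contDiff_const.prodMk contDiff_id)
  have hA : ContDiff ℝ 1 (fun z : Vd d => secT y + √(2*t) • z) := by fun_prop
  have e : ∀ z, fderiv ℝ (fun z : Vd d => gradv (φ t) (secT y + √(2*t) • z) i) z (Pi.single i 1)
      = √(2*t) * D2 (φ t) (secT y + √(2*t) • z) (Pi.single i 1) (Pi.single i 1) := by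
    intro z
    have hz : HasFDerivAt (fun z : Vd d => secT y + √(2*t) • z) (√(2*t) • ContinuousLinearMap.id ℝ (Vd d)) z :=
      ((hasFDerivAt_id z).const_smul (√(2*t))).const_add (secT y)
    have := ((hG.differentiable (by norm_num) (secT y + √(2*t) • z)).hasFDerivAt.comp z hz).fderiv
    change fderiv ℝ ((fun x => gradv (φ t) x i) ∘ fun z : Vd d => secT y + √(2*t) • z) z (Pi.single i 1) = _
    rw [this]
    simp only [ContinuousLinearMap.comp_apply, ContinuousLinearMap.smul_apply, ContinuousLinearMap.id_apply,
      map_smul, smul_eq_mul]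
    rfl
  have := lv_stein (ψ := fun z => gradv (φ t) (secT y + √(2*t) • z) i) (hG.comp hA) i (C := C) (D := √(2*t) * D)
    (fun z => h1 t ⟨le_rfl, le_rfl⟩ _) (fun z => by
      rw [e, abs_mul, abs_of_nonneg (Real.sqrt_nonneg _)]
      exact mul_le_mul_of_nonneg_left (h3 t ⟨le_rfl, le_rfl⟩ _) (Real.sqrt_nonneg _))
  simp_rw [e] at this
  exact this

lemma lv_heat_pt (hφ : IsTestFun φ) {t : ℝ} (ht : 0 < t) (q : Td d × Vd d) :
    HasDerivAt (fun s => φ s (lvX s q)) (tderiv φ t (lvX t q) +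
      (√(2*t))⁻¹ * ∑ i, q.2 i * gradv (φ t) (lvX t q) i) t := by
  have h1 : HasDerivAt (fun s => (s, lvX s q)) ((1:ℝ), (√(2*t))⁻¹ • q.2) t := by
    refine (hasDerivAt_id t).prodMk ?_
    have hs : HasDerivAt (fun s : ℝ => √(2*s)) ((√(2*t))⁻¹) t := by
      have := ((hasDerivAt_id' t).const_mul 2).sqrt (by positivity)
      refine this.congr_deriv ?_
      field_simp
    exact (hs.smul_const q.2).const_add _
  have h2 := (hφ.1.differentiable (by norm_num) (t, lvX t q)).hasFDerivAt.comp_hasDerivAt t h1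
  refine HasDerivAt.congr_deriv (f := fun s => φ s (lvX s q)) h2 ?_
  rw [lv_td_eq hφ.1]
  have e : ((1:ℝ), (√(2*t))⁻¹ • q.2) = ((1:ℝ), (0 : Vd d)) + (√(2*t))⁻¹ • ((0:ℝ), q.2) := by simp
  rw [e, map_add, map_smul, ← lv_grad_eq hφ.1, smul_eq_mul]
  congr 2
  conv_lhs => rw [pi_eq_sum_univ' q.2]
  rw [map_sum]
  refine Finset.sum_congr rfl fun i _ => ?_
  rw [map_smul, smul_eq_mul]
  rfl

lemma lv_heat_deriv (hφ : IsTestFun φ) (μ : PTd d) {t : ℝ} (ht : 0 < t) :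
    HasDerivAt (fun s => ∫ q, φ s (lvX s q) ∂((μ : Measure (Td d)).prod (lvγ d)))
      (∫ q, (tderiv φ t (lvX t q) + lapl (φ t) (lvX t q)) ∂((μ : Measure (Td d)).prod (lvγ d))) t := by
  obtain ⟨C1, p1, b1⟩ := lv_per_bd (lv_td_cont hφ.1) (lv_td_per hφ) (t/2) (2*t)
  choose C2 p2 b2 using fun i => lv_per_bd (lv_gr_cont hφ.1 i) (fun t x z => lv_gr_per hφ t x z i) (t/2) (2*t)
  have hm : ∀ s, AEStronglyMeasurable (fun q : Td d × Vd d => φ s (lvX s q)) ((μ : Measure (Td d)).prod (lvγ d)) :=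
    fun s => (lv_comp_int μ (K := fun q => φ q.1 q.2) hφ.1.continuous hφ.2 s).aestronglyMeasurable
  have itd := lv_comp_int μ (lv_td_cont hφ.1) (lv_td_per hφ) t
  have igr := fun i => lv_z_comp_int μ (lv_gr_cont hφ.1 i) (fun t x z => lv_gr_per hφ t x z i) t i
  have iD := fun i => lv_comp_int μ (lv_D2_cont hφ (Pi.single i 1) (Pi.single i 1))
    (fun t x z => lv_D2_per hφ t x z (Pi.single i 1) (Pi.single i 1)) t
  have h := hasDerivAt_integral_of_dominated_loc_of_deriv_le (𝕜 := ℝ)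
    (μ := (μ : Measure (Td d)).prod (lvγ d))
    (F := fun s q => φ s (lvX s q)) (x₀ := t) (s := Ioo (t/2) (2*t))
    (F' := fun s q => tderiv φ s (lvX s q) + (√(2*s))⁻¹ * ∑ i, q.2 i * gradv (φ s) (lvX s q) i)
    (bound := fun q => C1 + (√t)⁻¹ * ∑ i, |q.2 i| * C2 i)
    (Ioo_mem_nhds (by linarith) (by linarith)) (Eventually.of_forall hm)
    (lv_comp_int μ (K := fun q => φ q.1 q.2) hφ.1.continuous hφ.2 t)
    (itd.add ((integrable_finsetSum _ fun i _ => igr i).const_mul _)).aestronglyMeasurable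
    (Eventually.of_forall fun q s hs => by
      have hs' : s ∈ Icc (t/2) (2*t) := ⟨hs.1.le, hs.2.le⟩
      rw [Real.norm_eq_abs]
      refine (abs_add_le _ _).trans (add_le_add (b1 s hs' _) ?_)
      rw [abs_mul, abs_of_nonneg (by positivity)]
      have : √t ≤ √(2*s) := Real.sqrt_le_sqrt (by linarith [hs.1])
      refine mul_le_mul ?_ ?_ (abs_nonneg _) (by positivity)
      · exact inv_anti₀ (Real.sqrt_pos.2 ht) this
      · refine (Finset.abs_sum_le_sum_abs _ _).trans (Finset.sum_le_sum fun i _ => ?_)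
        rw [abs_mul]
        exact mul_le_mul_of_nonneg_left (b2 i s hs' _) (abs_nonneg _))
    ((integrable_const _).add ((integrable_finsetSum _ fun i _ => (lv_z_prod μ i).mul_const _).const_mul _))
    (Eventually.of_forall fun q s hs => lv_heat_pt hφ (by linarith [hs.1]) q)
  refine h.2.congr_deriv ?_
  have hsq : √(2*t) ≠ 0 := (Real.sqrt_pos.2 (by linarith)).ne'
  unfold lapl
  rw [integral_add itd ((integrable_finsetSum _ fun i _ => igr i).const_mul _),
    integral_add itd (integrable_finsetSum _ fun i _ => iD i), integral_const_mul,
    integral_finsetSum _ (fun i _ => igr i), integral_finsetSum _ (fun i _ => iD i)]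
  congr 1
  rw [Finset.mul_sum]
  refine Finset.sum_congr rfl fun i _ => ?_
  rw [lv_stein_heat hφ μ i, inv_mul_cancel_left₀ hsq]

lemma lv_heat_contOn (hφ : IsTestFun φ) (μ : PTd d) (a b : ℝ) :
    ContinuousOn (fun s => ∫ q, φ s (lvX s q) ∂((μ : Measure (Td d)).prod (lvγ d))) (Icc a b) := by
  obtain ⟨C1, p1, b1⟩ := lv_per_bd (K := fun q => φ q.1 q.2) hφ.1.continuous hφ.2 a b
  refine continuousOn_of_dominated (bound := fun _ => C1) ?_ ?_ (integrable_const _) ?_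
  · exact fun s _ => (lv_comp_int μ (K := fun q => φ q.1 q.2) hφ.1.continuous hφ.2 s).aestronglyMeasurable
  · exact fun s hs => Eventually.of_forall fun q => b1 s hs _
  · refine Eventually.of_forall fun q => ?_
    refine Continuous.continuousOn ?_
    unfold lvX
    exact hφ.1.continuous.comp (continuous_id.prodMk (by fun_prop : Continuous fun s : ℝ => secT q.1 + √(2*s) • q.2))

lemma lv_heat_FP (μ : PTd d) {a b : ℝ} (ha : 0 ≤ a) (hab : a ≤ b) :
    FPeq 1 (lvheat μ) (fun _ _ => 0) a b := by
  intro φ hφ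
  have hm : ∀ s, Measurable (φ s) := fun s =>
    (hφ.1.continuous.comp (Continuous.prodMk_right s)).measurable
  rw [lv_heat_int μ b (hm b) (hφ.2 b), lv_heat_int μ a (hm a) (hφ.2 a)]
  have hI := lv_FPint hφ 1 hab (m := lvheat μ) (α := fun _ _ => 0) (lv_heat_W1cont μ _) measurable_const
    (by simp [sqnorm])
  have e : ∀ s, ∫ y, (tderiv φ s (secT y) + 1 * lapl (φ s) (secT y)
        - dotp 0 (gradv (φ s) (secT y))) ∂(lvheat μ s : Measure (Td d)) =
        ∫ q, (tderiv φ s (lvX s q) + lapl (φ s) (lvX s q)) ∂((μ : Measure (Td d)).prod (lvγ d)) := by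
    intro s
    simp only [dotp, Pi.zero_apply, zero_mul, Finset.sum_const_zero, sub_zero, one_mul]
    refine lv_heat_int μ s (f := fun x => tderiv φ s x + lapl (φ s) x) ?_ ?_
    · exact (((lv_td_cont hφ.1).add (lv_la_cont hφ.1)).comp (Continuous.prodMk_right s)).measurable
    · intro x z
      unfold lapl
      simp_rw [lv_td_per hφ, lv_D2_per hφ]
  simp_rw [e] at hI ⊢
  exact (intervalIntegral.integral_eq_sub_of_hasDerivAt_of_le hab (lv_heat_contOn hφ μ a b)
    (fun t ht => lv_heat_deriv hφ μ (by linarith [ht.1])) hI).symm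
end heatFP

section values
variable {d : ℕ}

lemma lv_taylor {h h' h'' : ℝ → ℝ} {c : ℝ} (h1 : ∀ s, HasDerivAt h (h' s) s)
    (h2 : ∀ s, HasDerivAt h' (h'' s) s) (hc : ∀ s, c ≤ h'' s) : h 0 + h' 0 + c / 2 ≤ h 1 := by
  have k1 : ∀ s, HasDerivAt (fun s => h' s - c * s) (h'' s - c * 1) s := fun s =>
    (h2 s).fun_sub ((hasDerivAt_id' s).const_mul c)
  have m1 : Monotone (fun s => h' s - c * s) :=
    monotone_of_deriv_nonneg (fun s => (k1 s).differentiableAt) fun s => by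
      rw [(k1 s).deriv]; linarith [hc s]
  have k2 : ∀ s, HasDerivAt (fun s => h s - (h' 0 * s + c / 2 * s^2)) (h' s - (h' 0 * 1 + c/2 * (2 * s))) s := by
    intro s
    have h4 : HasDerivAt (fun t : ℝ => t^2) (2 * s) s := by
      simpa using hasDerivAt_pow 2 s
    exact (h1 s).fun_sub (((hasDerivAt_id' s).const_mul (h' 0)).fun_add (h4.const_mul (c/2)))
  have m2 : MonotoneOn (fun s => h s - (h' 0 * s + c / 2 * s^2)) (Icc 0 1) := by
    refine monotoneOn_of_deriv_nonneg (convex_Icc 0 1)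
      (fun s _ => (k2 s).continuousAt.continuousWithinAt) (fun s _ => (k2 s).differentiableAt.differentiableWithinAt) ?_
    intro s hs
    rw [interior_Icc] at hs
    rw [(k2 s).deriv]
    have := m1 hs.1.le
    simp only at this
    linarith
  have := m2 (left_mem_Icc.2 zero_le_one) (right_mem_Icc.2 zero_le_one) zero_le_one
  simp only at this
  linarith

lemma lv_H_lower (S : MFGSetting d) (x p : Vd d) :
    S.H x 0 + fderiv ℝ (fun p => S.H x p) 0 p + S.Cbar⁻¹ * sqnorm p / 2 ≤ S.H x p := by
  have hC : ContDiff ℝ 2 (fun p => S.H x p) := S.H_smooth.comp (contDiff_const.prodMk contDiff_id)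
  have hC1 : ContDiff ℝ 1 (fun y => fderiv ℝ (fun p => S.H x p) y p) :=
    (hC.fderiv_right (m := 1) (by norm_num)).clm_apply contDiff_const
  have hl : ∀ s : ℝ, HasDerivAt (fun s : ℝ => s • p) p s := by
    intro s
    simpa using (hasDerivAt_id' s).smul_const p
  have := lv_taylor (h := fun s => S.H x (s • p)) (h' := fun s => fderiv ℝ (fun p => S.H x p) (s • p) p)
    (h'' := fun s => D2 (fun p => S.H x p) (s • p) p p) (c := S.Cbar⁻¹ * sqnorm p)
    (fun s => (hC.differentiable (by norm_num) _).hasFDerivAt.comp_hasDerivAt s (hl s))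
    (fun s => (hC1.differentiable (by norm_num) _).hasFDerivAt.comp_hasDerivAt s (hl s))
    (fun s => S.Dpp_lower x _ p)
  simpa using this

lemma lv_Hstar_bd (S : MFGSetting d) : ∃ M : ℝ, 0 ≤ M ∧ (∀ (y : Td d) (q : Vd d), -M ≤ S.Hstar (secT y) q) ∧
    ∀ y : Td d, S.Hstar (secT y) 0 ≤ M := by
  have hc : IsCompact (Icc (0 : Vd d) 1) := isCompact_Icc
  have c1 : Continuous (fun x => S.H x 0) := S.H_smooth.continuous.comp (continuous_id.prodMk continuous_const)
  obtain ⟨A, hA⟩ := hc.exists_bound_of_continuousOn c1.continuousOn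
  have c2 : ∀ i : Fin d, Continuous (fun x : Vd d => fderiv ℝ (fun p => S.H x p) 0 (Pi.single i 1)) := by
    intro i
    have e : ∀ x : Vd d, fderiv ℝ (fun p => S.H x p) 0 (Pi.single i 1) =
        fderiv ℝ (fun q : Vd d × Vd d => S.H q.1 q.2) (x, 0) (0, Pi.single i 1) := by
      intro x
      have h1 : HasFDerivAt (fun x' : Vd d => (x, x')) (ContinuousLinearMap.inr ℝ (Vd d) (Vd d)) 0 :=
        hasFDerivAt_prodMk_right x 0
      have := ((S.H_smooth.differentiable (by norm_num) (x, 0)).hasFDerivAt.comp (0 : Vd d) h1).fderiv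
      change fderiv ℝ ((fun q : Vd d × Vd d => S.H q.1 q.2) ∘ fun x' => (x, x')) 0 _ = _
      rw [this]; simp
    simp_rw [e]
    exact ((S.H_smooth.continuous_fderiv (by norm_num)).clm_apply continuous_const).comp
      (continuous_id.prodMk continuous_const)
  choose B hB using fun i => hc.exists_bound_of_continuousOn (c2 i).continuousOn
  have hCp := S.Cbar_pos
  refine ⟨|A| + ∑ i, S.Cbar * (B i)^2 / 2, ?_, ?_, ?_⟩
  · have : 0 ≤ ∑ i, S.Cbar * (B i)^2 / 2 := Finset.sum_nonneg fun i _ => by positivity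
    positivity
  · intro y q
    have : 0 ≤ ∑ i, S.Cbar * (B i)^2 / 2 := Finset.sum_nonneg fun i _ => by positivity
    have h := (S.Hstar_eq (secT y) q).1 ⟨0, rfl⟩
    simp only [dotp, Pi.zero_apply, mul_zero, Finset.sum_const_zero, zero_sub] at h
    have h2 := hA _ (lv_secT_mem y)
    rw [Real.norm_eq_abs] at h2
    linarith [le_abs_self A, le_abs_self (S.H (secT y) 0)]
  · intro y
    refine (S.Hstar_eq (secT y) 0).2 ?_
    rintro _ ⟨p, rfl⟩
    simp only [dotp, Pi.zero_apply, zero_mul, Finset.sum_const_zero, zero_sub]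
    have h := lv_H_lower S (secT y) p
    have h2 := hA _ (lv_secT_mem y)
    rw [Real.norm_eq_abs] at h2
    have h3 : -∑ i, S.Cbar * (B i)^2 / 2 ≤ fderiv ℝ (fun p => S.H (secT y) p) 0 p + S.Cbar⁻¹ * sqnorm p / 2 := by
      have e : fderiv ℝ (fun p => S.H (secT y) p) 0 p =
          ∑ i, p i * fderiv ℝ (fun p => S.H (secT y) p) 0 (Pi.single i 1) := by
        conv_lhs => rw [pi_eq_sum_univ' p]
        rw [map_sum]
        refine Finset.sum_congr rfl fun i _ => ?_
        rw [map_smul, smul_eq_mul]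
      rw [e]
      unfold sqnorm
      rw [Finset.mul_sum, Finset.sum_div, ← Finset.sum_add_distrib, ← Finset.sum_neg_distrib]
      refine Finset.sum_le_sum fun i _ => ?_
      have h4 := hB i _ (lv_secT_mem y)
      rw [Real.norm_eq_abs] at h4
      set D := fderiv ℝ (fun p => S.H (secT y) p) 0 (Pi.single i 1)
      have h5 : D^2 ≤ (B i)^2 := by
        rw [← sq_abs D]
        gcongr
      have h6 : 0 ≤ S.Cbar⁻¹ / 2 * (p i + S.Cbar * D)^2 := by positivity
      have h7 : S.Cbar⁻¹ / 2 * (p i + S.Cbar * D)^2 = S.Cbar⁻¹ * (p i)^2/2 + p i * D + S.Cbar * D^2/2 := by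
        field_simp
        ring
      nlinarith
    linarith [neg_abs_le (S.H (secT y) 0), le_abs_self A]

lemma lv_Hstar_meas (S : MFGSetting d) : Measurable (fun x => S.Hstar x 0) := by
  refine measurable_of_Ioi fun a => ?_
  have : (fun x => S.Hstar x 0) ⁻¹' Ioi a = ⋃ p, {x | a < - S.H x p} := by
    ext x
    simp only [mem_preimage, mem_Ioi, mem_iUnion, mem_setOf_eq]
    rw [lt_isLUB_iff (S.Hstar_eq x 0)]
    simp [dotp]
  rw [this]
  refine (isOpen_iUnion fun p => ?_).measurableSet
  refine isOpen_lt continuous_const ?_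
  exact (S.H_smooth.continuous.comp (continuous_id.prodMk continuous_const)).neg

/-- the basic bounds -/
def lvBd (S : MFGSetting d) (M : ℝ) : Prop :=
  0 ≤ M ∧ (∀ m α s, -M ≤ runCost S m α s) ∧ ∀ μ s, runCost S (lvheat μ) (fun _ _ => 0) s ≤ M

lemma lv_exBd (S : MFGSetting d) : ∃ M, lvBd S M := by
  obtain ⟨M, h0, h1, h2⟩ := lv_Hstar_bd S
  obtain ⟨N, hN⟩ := S.Fc_bounded
  have hN' : ∀ μ, -|N| ≤ S.Fc μ ∧ S.Fc μ ≤ |N| := fun μ =>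
    abs_le.1 ((hN μ).trans (le_abs_self _))
  refine ⟨M + |N|, by positivity, ?_, ?_⟩
  · intro m α s
    unfold runCost
    have : -M ≤ ∫ y, S.Hstar (secT y) (α s y) ∂(m s : Measure (Td d)) := by
      by_cases hi : Integrable (fun y => S.Hstar (secT y) (α s y)) (m s : Measure (Td d))
      · have := integral_mono (integrable_const (-M)) hi (fun y => h1 y _)
        simpa using this
      · rw [integral_undef hi]; linarith
    linarith [(hN' (m s)).1]
  · intro μ s
    unfold runCost
    have hi : Integrable (fun y => S.Hstar (secT y) 0) (lvheat μ s : Measure (Td d)) := by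
      refine Integrable.of_bound (C := M) ?_ (Eventually.of_forall fun y => abs_le.2 ⟨h1 y 0, h2 y⟩)
      exact ((lv_Hstar_meas S).comp lv_secT_meas).aestronglyMeasurable
    have := integral_mono hi (integrable_const M) (fun y => h2 y)
    simp only [integral_const, probReal_univ, one_smul] at this
    linarith [(hN' (lvheat μ s)).2]

lemma lv_heat_rc_meas (S : MFGSetting d) (μ : PTd d) :
    StronglyMeasurable (runCost S (lvheat μ) (fun _ _ => 0)) := by
  unfold runCost
  refine StronglyMeasurable.add ?_ (lv_heat_Fc_cont S μ).stronglyMeasurable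
  exact lv_kernel_int (lv_heat_W1cont μ univ) (r := fun s => s) continuous_id (fun _ => mem_univ _)
    (G := fun q => S.Hstar (secT q.2) 0) ((lv_Hstar_meas S).comp (lv_secT_meas.comp measurable_snd))

lemma lv_expint {δ : ℝ} (hδ : 0 < δ) : IntegrableOn (fun s => Real.exp (-δ * s)) (Ioi 0) :=
  exp_neg_integrableOn_Ioi 0 hδ

lemma lv_expval {δ : ℝ} (hδ : 0 < δ) : ∫ s in Ioi (0:ℝ), Real.exp (-δ * s) = 1 / δ := by
  rw [integral_exp_mul_Ioi (by linarith)]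
  simp

lemma lv_heat_adm (S : MFGSetting d) {δ : ℝ} (hδ : 0 < δ) (μ : PTd d) :
    AdmDisc S 1 δ μ (lvheat μ) (fun _ _ => 0) := by
  obtain ⟨M, h0, h1, h2⟩ := lv_exBd S
  refine ⟨lv_heat_zero μ, lv_heat_W1cont μ _, fun s₁ s₂ h h' => lv_heat_FP μ h h', measurable_const,
    by simp [sqnorm], ?_⟩
  refine Integrable.mul_bdd (c := M) (lv_expint hδ) (lv_heat_rc_meas S μ).aestronglyMeasurable
    (Eventually.of_forall fun s => ?_)
  exact abs_le.2 ⟨h1 _ _ s, h2 μ s⟩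

lemma lv_disc_ge (S : MFGSetting d) {M : ℝ} (hM : lvBd S M) {δ : ℝ} (hδ : 0 < δ) {μ : PTd d} {m α}
    (h : AdmDisc S 1 δ μ m α) : -(M / δ) ≤ costDisc S δ m α := by
  have := integral_mono ((lv_expint hδ).mul_const (-M)) h.2.2.2.2.2 (fun s =>
    mul_le_mul_of_nonneg_left (hM.2.1 m α s) (Real.exp_pos _).le)
  rw [integral_mul_const, lv_expval hδ] at this
  unfold costDisc
  refine le_trans (le_of_eq ?_) this
  ring

lemma lv_heat_le (S : MFGSetting d) {M : ℝ} (hM : lvBd S M) {δ : ℝ} (hδ : 0 < δ) (μ : PTd d) :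
    costDisc S δ (lvheat μ) (fun _ _ => 0) ≤ M / δ := by
  have := integral_mono (lv_heat_adm S hδ μ).2.2.2.2.2 ((lv_expint hδ).mul_const M) (fun s =>
    mul_le_mul_of_nonneg_left (hM.2.2 μ s) (Real.exp_pos _).le)
  rw [integral_mul_const, lv_expval hδ] at this
  unfold costDisc
  refine le_trans this (le_of_eq ?_)
  ring

lemma lv_V_le (S : MFGSetting d) {M : ℝ} (hM : lvBd S M) {δ : ℝ} (hδ : 0 < δ) {μ : PTd d} {m α}
    (h : AdmDisc S 1 δ μ m α) : Vfun S 1 δ μ ≤ costDisc S δ m α := by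
  refine csInf_le ⟨-(M/δ), ?_⟩ ⟨m, α, h, rfl⟩
  rintro _ ⟨m', α', h', rfl⟩
  exact lv_disc_ge S hM hδ h'

lemma lv_V_abs (S : MFGSetting d) {M : ℝ} (hM : lvBd S M) {δ : ℝ} (hδ : 0 < δ) (μ : PTd d) :
    |Vfun S 1 δ μ| ≤ M / δ := by
  rw [abs_le]
  constructor
  · refine le_csInf ⟨_, _, _, lv_heat_adm S hδ μ, rfl⟩ ?_
    rintro _ ⟨m', α', h', rfl⟩
    exact lv_disc_ge S hM hδ h'
  · exact (lv_V_le S hM hδ (lv_heat_adm S hδ μ)).trans (lv_heat_le S hM hδ μ)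

lemma lv_V_near (S : MFGSetting d) {δ : ℝ} (hδ : 0 < δ) (μ : PTd d) {ε : ℝ} (hε : 0 < ε) :
    ∃ m α, AdmDisc S 1 δ μ m α ∧ costDisc S δ m α < Vfun S 1 δ μ + ε := by
  obtain ⟨_, ⟨m, α, h, rfl⟩, h2⟩ := exists_lt_of_csInf_lt
    (s := { r | ∃ m α, AdmDisc S 1 δ μ m α ∧ r = costDisc S δ m α })
    ⟨_, _, _, lv_heat_adm S hδ μ, rfl⟩ (lt_add_of_pos_right (Vfun S 1 δ μ) hε)
  exact ⟨m, α, h, h2⟩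

lemma lv_U_ge (S : MFGSetting d) {M : ℝ} (hM : lvBd S M) {T : ℝ} (hT : 0 ≤ T) {μ : PTd d} {m α}
    (h : AdmOn S 1 μ T m α) : -(M * T) ≤ costT S m α T := by
  have := intervalIntegral.integral_mono_on hT (intervalIntegrable_const (c := -M)) h.2.2.2.2.2
    (fun s _ => hM.2.1 m α s)
  unfold costT
  refine le_trans (le_of_eq ?_) this
  simp
  ring

lemma lv_U_le (S : MFGSetting d) {M : ℝ} (hM : lvBd S M) {T : ℝ} (hT : 0 ≤ T) {μ : PTd d} {m α}
    (h : AdmOn S 1 μ T m α) : Ufun S 1 T μ ≤ costT S m α T := by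
  refine csInf_le ⟨-(M*T), ?_⟩ ⟨m, α, h, rfl⟩
  rintro _ ⟨m', α', h', rfl⟩
  exact lv_U_ge S hM hT h'

lemma lv_U_ne (S : MFGSetting d) {T : ℝ} (hT : 0 ≤ T) (μ : PTd d) :
    { r | ∃ m α, AdmOn S 1 μ T m α ∧ r = costT S m α T }.Nonempty :=
  ⟨_, _, _, lv_disc_restrict S one_pos hT (lv_heat_adm S one_pos μ), rfl⟩

lemma lv_U_near (S : MFGSetting d) {T : ℝ} (hT : 0 ≤ T) (μ : PTd d) {ε : ℝ} (hε : 0 < ε) :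
    ∃ m α, AdmOn S 1 μ T m α ∧ costT S m α T < Ufun S 1 T μ + ε := by
  obtain ⟨_, ⟨m, α, h, rfl⟩, h2⟩ := exists_lt_of_csInf_lt
    (s := { r | ∃ m α, AdmOn S 1 μ T m α ∧ r = costT S m α T })
    (lv_U_ne S hT μ) (lt_add_of_pos_right (Ufun S 1 T μ) hε)
  exact ⟨m, α, h, h2⟩

lemma lv_V_dpp (S : MFGSetting d) {M : ℝ} (hM : lvBd S M) {δ T : ℝ} (hδ : 0 < δ) (hT : 0 ≤ T) {μ : PTd d} {m α}
    (h : AdmOn S 1 μ T m α) :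
    Vfun S 1 δ μ ≤ (∫ s in (0:ℝ)..T, Real.exp (-δ*s) * runCost S m α s)
      + Real.exp (-δ*T) * Vfun S 1 δ (m T) := by
  refine le_of_forall_pos_le_add fun ε hε => ?_
  obtain ⟨m₂, α₂, h2, h3⟩ := lv_V_near S hδ (m T) hε
  obtain ⟨m', α', h4, h5⟩ := lv_disc_concat S hδ hT h h2
  have := lv_V_le S hM hδ h4
  rw [h5] at this
  have e1 : Real.exp (-δ*T) ≤ 1 := Real.exp_le_one_iff.2 (by nlinarith)
  have e0 := Real.exp_pos (-δ*T)
  nlinarith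
end values

section tauber
variable {d : ℕ}

lemma lv_ibp {L : ℝ → ℝ} {δ T : ℝ} (hL : IntervalIntegrable L volume 0 T) :
    ∫ s in (0:ℝ)..T, L s = Real.exp (δ*T) * (∫ r in (0:ℝ)..T, Real.exp (-δ*r) * L r) -
      δ * ∫ s in (0:ℝ)..T, Real.exp (δ*s) * ∫ r in (0:ℝ)..s, Real.exp (-δ*r) * L r := by
  have hE : IntervalIntegrable (fun s => Real.exp (-δ * s) * L s) volume 0 T := lv_exp_int_iff.2 hL
  have hK := hE.absolutelyContinuousOnInterval_intervalIntegral (c := 0) (by simp)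
  have hX : AbsolutelyContinuousOnInterval (fun s : ℝ => Real.exp (δ*s)) 0 T :=
    ContDiffOn.absolutelyContinuousOnInterval (ContDiff.contDiffOn (by fun_prop))
  have h := AbsolutelyContinuousOnInterval.integral_mul_deriv_eq_deriv_mul hX hK
  have hd : ∀ s : ℝ, deriv (fun s : ℝ => Real.exp (δ*s)) s = δ * Real.exp (δ*s) := by
    intro s
    have := ((hasDerivAt_id' s).const_mul δ).exp.deriv
    rw [this]; ring
  have e1 : ∫ s in (0:ℝ)..T, L s = ∫ s in (0:ℝ)..T, Real.exp (δ*s) *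
      deriv (fun x => ∫ v in (0:ℝ)..x, Real.exp (-δ * v) * L v) s := by
    refine intervalIntegral.integral_congr_ae ?_
    filter_upwards [hE.ae_hasDerivAt_integral] with s hs hs'
    have h2 := hs (uIoc_subset_uIcc hs') 0 (by simp)
    rw [h2.deriv, ← mul_assoc, ← Real.exp_add]
    simp
  rw [e1, h]
  simp_rw [hd]
  simp only [intervalIntegral.integral_same, mul_zero, sub_zero]
  congr 1
  rw [← intervalIntegral.integral_const_mul]
  simp_rw [mul_assoc]

/-- the shifted value -/
def lvJ (L : ℝ → ℝ) (δ T c a : ℝ) : ℝ :=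
  Real.exp (δ*a) * ((∫ r in (0:ℝ)..T, Real.exp (-δ*r) * L r) - ∫ r in (0:ℝ)..a, Real.exp (-δ*r) * L r)
    + Real.exp (-δ*(T-a)) * c

lemma lvJ_zero (L : ℝ → ℝ) (δ T c : ℝ) :
    lvJ L δ T c 0 = (∫ r in (0:ℝ)..T, Real.exp (-δ*r) * L r) + Real.exp (-δ*T) * c := by
  simp [lvJ]

lemma lv_Jcont {L : ℝ → ℝ} {δ T : ℝ} (c : ℝ) (hT : 0 ≤ T) (hL : IntervalIntegrable L volume 0 T) :
    ContinuousOn (lvJ L δ T c) (uIcc 0 T) := by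
  have hE : IntervalIntegrable (fun s => Real.exp (-δ * s) * L s) volume 0 T := lv_exp_int_iff.2 hL
  have hK := (hE.absolutelyContinuousOnInterval_intervalIntegral (c := 0) (by simp)).continuousOn
  unfold lvJ
  refine ContinuousOn.add (ContinuousOn.mul (by fun_prop) (continuousOn_const.sub hK)) (by fun_prop)

lemma lv_Jid {L : ℝ → ℝ} {δ T : ℝ} (c : ℝ) (hδ : 0 < δ) (hT : 0 ≤ T) (hL : IntervalIntegrable L volume 0 T) :
    ∫ s in (0:ℝ)..T, L s = δ * (∫ s in (0:ℝ)..T, lvJ L δ T c s) - c + lvJ L δ T c 0 := by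
  have hE : IntervalIntegrable (fun s => Real.exp (-δ * s) * L s) volume 0 T := lv_exp_int_iff.2 hL
  have hK := (hE.absolutelyContinuousOnInterval_intervalIntegral (c := 0) (by simp)).continuousOn
  set KT := ∫ r in (0:ℝ)..T, Real.exp (-δ*r) * L r with hKT
  have ie : ∫ s in (0:ℝ)..T, Real.exp (δ*s) = (Real.exp (δ*T) - 1)/δ := by
    rw [intervalIntegral.integral_comp_mul_left (fun x => Real.exp x) hδ.ne', integral_exp]
    simp; ring
  have e : ∫ s in (0:ℝ)..T, lvJ L δ T c s = (KT + Real.exp (-δ*T) * c) * ((Real.exp (δ*T) - 1)/δ)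
      - ∫ s in (0:ℝ)..T, Real.exp (δ*s) * ∫ r in (0:ℝ)..s, Real.exp (-δ*r) * L r := by
    rw [← ie, ← intervalIntegral.integral_const_mul, ← intervalIntegral.integral_sub]
    · congr 1
      funext s
      unfold lvJ
      rw [show -δ*(T-s) = -δ*T + δ*s by ring, Real.exp_add]
      ring
    · exact Continuous.intervalIntegrable (by fun_prop) _ _
    · exact ContinuousOn.intervalIntegrable (ContinuousOn.mul (by fun_prop) hK)
  rw [lvJ_zero, e, lv_ibp hL (δ := δ), ← hKT]
  have : Real.exp (-δ*T) * Real.exp (δ*T) = 1 := by rw [← Real.exp_add]; simp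
  have e5 : δ * ((Real.exp (δ*T) - 1)/δ) = Real.exp (δ*T) - 1 := by field_simp
  linear_combination (-(KT + Real.exp (-δ*T) * c)) * e5 - c * this

lemma lv_Jlower {L : ℝ → ℝ} {δ T : ℝ} {c u : ℝ} (hδ : 0 < δ) (hT : 0 ≤ T) (hL : IntervalIntegrable L volume 0 T)
    (h : ∀ a ∈ Icc 0 T, u ≤ lvJ L δ T c a) : δ * T * u - c + u ≤ ∫ s in (0:ℝ)..T, L s := by
  rw [lv_Jid c hδ hT hL]
  have h1 := h 0 ⟨le_rfl, hT⟩
  have h2 := intervalIntegral.integral_mono_on hT (intervalIntegrable_const (μ := volume) (c := u))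
    (lv_Jcont c hT hL).intervalIntegrable h
  simp only [intervalIntegral.integral_const, sub_zero, smul_eq_mul] at h2
  have := mul_le_mul_of_nonneg_left h2 hδ.le
  nlinarith

lemma lv_Jupper {L : ℝ → ℝ} {δ T : ℝ} {c u : ℝ} (hδ : 0 < δ) (hT : 0 ≤ T) (hL : IntervalIntegrable L volume 0 T)
    (h : ∀ a ∈ Icc 0 T, lvJ L δ T c a ≤ u) : ∫ s in (0:ℝ)..T, L s ≤ δ * T * u - c + u := by
  rw [lv_Jid c hδ hT hL]
  have h1 := h 0 ⟨le_rfl, hT⟩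
  have h2 := intervalIntegral.integral_mono_on hT
    (lv_Jcont c hT hL).intervalIntegrable (intervalIntegrable_const (μ := volume) (c := u)) h
  simp only [intervalIntegral.integral_const, sub_zero, smul_eq_mul] at h2
  have := mul_le_mul_of_nonneg_left h2 hδ.le
  nlinarith

lemma lv_U_lower (S : MFGSetting d) {M : ℝ} (hM : lvBd S M) {δ T w : ℝ} (hδ : 0 < δ) (hT : 0 ≤ T)
    (hV : ∀ μ, w ≤ δ * Vfun S 1 δ μ) (μ : PTd d) : T * w - M/δ + w/δ ≤ Ufun S 1 T μ := by
  refine le_csInf (lv_U_ne S hT μ) ?_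
  rintro _ ⟨m, α, h, rfl⟩
  have hI := h.2.2.2.2.2
  have key := lv_Jlower (c := Vfun S 1 δ (m T)) (u := w/δ) hδ hT hI (by
    intro a ha
    have h1 := lv_V_dpp S hM hδ (T := T - a) (by linarith [ha.2]) (lv_on_shift S ha.1 h ha.2)
    have h2 : w/δ ≤ Vfun S 1 δ (m a) := by
      rw [div_le_iff₀ hδ, mul_comm]; exact hV _
    refine h2.trans (h1.trans (le_of_eq ?_))
    unfold lvJ
    simp only [sub_add_cancel]
    congr 1
    have hE : IntervalIntegrable (fun s => Real.exp (-δ * s) * runCost S m α s) volume 0 T := lv_exp_int_iff.2 hI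
    rw [intervalIntegral.integral_interval_sub_left hE (hE.mono_set (by
      rw [uIcc_of_le ha.1, uIcc_of_le hT]; exact Icc_subset_Icc_right ha.2)),
      ← intervalIntegral.integral_const_mul]
    have := intervalIntegral.integral_comp_add_right (a := 0) (b := T - a)
      (fun s => Real.exp (δ*a) * (Real.exp (-δ * s) * runCost S m α s)) a
    simp only [zero_add, sub_add_cancel] at this
    rw [← this]
    congr 1
    funext s
    rw [← mul_assoc, ← Real.exp_add]
    have e7 : δ*a + -δ*(s+a) = -δ*s := by ring
    rw [e7]; rfl)
  have h3 := (abs_le.1 (lv_V_abs S hM hδ (m T))).2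
  unfold costT
  have e : δ * T * (w/δ) = T * w := by field_simp
  rw [e] at key
  linarith

lemma lv_U_upper (S : MFGSetting d) {M : ℝ} (hM : lvBd S M) {δ T w ε : ℝ} (hδ : 0 < δ) (hT : 0 ≤ T) (hε : 0 < ε)
    (hV : ∀ μ, δ * Vfun S 1 δ μ ≤ w) (μ : PTd d) : Ufun S 1 T μ ≤ T * (w+ε) + M/δ + (w+ε)/δ := by
  obtain ⟨m, α, h, hn⟩ := lv_V_near S hδ μ (ε := Real.exp (-δ*T) * (ε/δ)) (by positivity)
  have hA := lv_disc_restrict S hδ hT h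
  have hI := hA.2.2.2.2.2
  have key := lv_Jupper (c := costDisc S δ (fun t => m (t+T)) (fun t => α (t+T))) (u := (w+ε)/δ) hδ hT hI (by
    intro a ha
    have s1 := lv_disc_split S hT h
    have s3 := lv_V_dpp S hM hδ ha.1 (lv_disc_restrict S hδ ha.1 h)
    have h2 : Vfun S 1 δ (m a) ≤ w/δ := by
      rw [le_div_iff₀ hδ, mul_comm]; exact hV _
    unfold lvJ
    have e1 : Real.exp (-δ*(T-a)) = Real.exp (δ*a) * Real.exp (-δ*T) := by
      rw [← Real.exp_add]; congr 1; ring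
    have e2 : Real.exp (δ*a) * Real.exp (-δ*a) = 1 := by
      rw [← Real.exp_add]; simp
    have e3 : Real.exp (-δ*(T-a)) ≤ 1 := Real.exp_le_one_iff.2 (by nlinarith [ha.2])
    have p := Real.exp_pos (δ*a)
    have hh : (∫ r in (0:ℝ)..T, Real.exp (-δ*r) * runCost S m α r) + Real.exp (-δ*T) *
        costDisc S δ (fun t => m (t+T)) (fun t => α (t+T)) - (∫ r in (0:ℝ)..a, Real.exp (-δ*r) * runCost S m α r)
        ≤ Real.exp (-δ*a) * Vfun S 1 δ (m a) + Real.exp (-δ*T) * (ε/δ) := by linarith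
    have h5 := mul_le_mul_of_nonneg_left hh p.le
    have h6 : Real.exp (δ*a) * (Real.exp (-δ*a) * Vfun S 1 δ (m a) + Real.exp (-δ*T) * (ε/δ)) =
        Vfun S 1 δ (m a) + Real.exp (-δ*(T-a)) * (ε/δ) := by
      rw [e1]; linear_combination (Vfun S 1 δ (m a)) * e2
    have h7 : Real.exp (-δ*(T-a)) * (ε/δ) ≤ ε/δ := mul_le_of_le_one_left (by positivity) e3
    rw [h6] at h5
    rw [e1, add_div]
    linarith)
  have h3 := (abs_le.1 (lv_V_abs S hM hδ (m T))).1
  have h4 := lv_V_le S hM hδ (lv_disc_shift S hT h)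
  have h5 := lv_U_le S hM hT hA
  unfold costT at h5
  have e : δ * T * ((w+ε)/δ) = T * (w+ε) := by field_simp
  rw [e] at key
  linarith

lemma lv_U_limit (S : MFGSetting d) (lam : ℝ) (hlam : ∃ δseq : ℕ → ℝ, (∀ n : ℕ, 0 < δseq n) ∧
      Filter.Tendsto δseq Filter.atTop (nhds 0) ∧
      ∀ ε > 0, ∃ N : ℕ, ∀ n ≥ N, ∀ μ : PTd d,
        |δseq n * Vfun S 1 (δseq n) μ - (-lam)| < ε) : IsLimitValueU S 1 lam := by
  obtain ⟨M, hM⟩ := lv_exBd S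
  obtain ⟨D, hD, -, hc⟩ := hlam
  intro ε hε
  obtain ⟨N, hN⟩ := hc (ε/4) (by positivity)
  have hN := hN N le_rfl
  set δ := D N
  have hδ : 0 < δ := hD N
  set A := M/δ + (|lam| + ε)/δ with hAd
  have hA : 0 ≤ A := by have := hM.1; positivity
  refine ⟨4 * A/ε + 1, fun T hT μ => ?_⟩
  have hT0 : 0 < T := lt_of_lt_of_le (by positivity) hT
  have h1 := lv_U_lower S hM (w := -lam - ε/4) hδ hT0.le (fun μ => by have := (abs_lt.1 (hN μ)).1; linarith) μ
  have h2 := lv_U_upper S hM (w := -lam + ε/4) (ε := ε/4) hδ hT0.le (by positivity)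
    (fun μ => by have := (abs_lt.1 (hN μ)).2; linarith) μ
  have h3 : 4 * A < ε * T := by
    have : 4 * A/ε < T := by linarith
    have := (div_lt_iff₀ hε).1 this
    linarith
  have h4 : (-lam + ε/4 + ε/4)/δ ≤ (|lam| + ε)/δ := by
    exact div_le_div_of_nonneg_right (by linarith [neg_abs_le lam]) hδ.le
  have h5 : -((|lam| + ε)/δ) ≤ (-lam - ε/4)/δ := by
    rw [← neg_div]
    exact div_le_div_of_nonneg_right (by linarith [le_abs_self lam]) hδ.le
  rw [abs_lt]
  constructor
  · have : -lam - ε < Ufun S 1 T μ / T := by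
      rw [lt_div_iff₀ hT0]; nlinarith
    linarith
  · have : Ufun S 1 T μ / T < -lam + ε := by
      rw [div_lt_iff₀ hT0]; nlinarith
    linarith

lemma lv_exp_bds {x : ℝ} (hx : 0 < x) : 0 < 1 - Real.exp (-x) ∧ 1 ≤ x / (1 - Real.exp (-x)) ∧
    x / (1 - Real.exp (-x)) ≤ 1 + x := by
  have h0 : 0 < 1 - Real.exp (-x) := by
    have := (Real.exp_lt_one_iff (x := -x)).2 (by linarith); linarith
  refine ⟨h0, ?_, ?_⟩
  · rw [le_div_iff₀ h0]
    linarith [Real.add_one_le_exp (-x)]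
  · rw [div_le_iff₀ h0]
    have h1 := Real.add_one_le_exp x
    have h2 : Real.exp x * Real.exp (-x) = 1 := by rw [← Real.exp_add]; simp
    have h3 := Real.exp_pos (-x)
    nlinarith

lemma lv_V_up (S : MFGSetting d) {M : ℝ} (hM : lvBd S M) {δ T u : ℝ} (hδ : 0 < δ) (hT : 0 < T)
    (hU : ∀ μ, Ufun S 1 T μ < u) (μ : PTd d) :
    (1 - Real.exp (-(δ*T))) * Vfun S 1 δ μ ≤ u + M * T * (1 - Real.exp (-(δ*T))) := by
  set κ := 1 - Real.exp (-(δ*T)) with hκ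
  have hκ0 : 0 < κ := (lv_exp_bds (by positivity)).1
  have hbdd : BddAbove (range (Vfun S 1 δ : PTd d → ℝ)) := ⟨M/δ, by
    rintro _ ⟨μ, rfl⟩; exact (abs_le.1 (lv_V_abs S hM hδ μ)).2⟩
  have hne : Nonempty (PTd d) := ⟨μ⟩
  set v := ⨆ μ, (Vfun S 1 δ : PTd d → ℝ) μ with hv
  have key : v ≤ u + M * T * κ + (1 - κ) * v := by
    refine ciSup_le fun μ => ?_
    obtain ⟨m, α, h, hn⟩ := lv_U_near S hT.le μ (ε := u - Ufun S 1 T μ) (by linarith [hU μ])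
    have h1 := lv_V_dpp S hM hδ hT.le h
    have h2 := le_ciSup hbdd (m T)
    have hI := h.2.2.2.2.2
    have hE : IntervalIntegrable (fun s => Real.exp (-δ * s) * runCost S m α s) volume 0 T := lv_exp_int_iff.2 hI
    have h3 := intervalIntegral.integral_mono_on hT.le hE (hI.add (intervalIntegrable_const (c := M * κ))) (by
      intro s hs
      have a1 : Real.exp (-δ*s) ≤ 1 := Real.exp_le_one_iff.2 (by nlinarith [hs.1])
      have a2 : 1 - κ ≤ Real.exp (-δ*s) := by
        rw [hκ, sub_sub_cancel]
        exact Real.exp_le_exp.2 (by nlinarith [hs.2])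
      have a3 := hM.2.1 m α s
      have := hM.1
      change _ ≤ runCost S m α s + M * κ
      nlinarith [mul_nonneg (sub_nonneg.2 a1) (by linarith : 0 ≤ runCost S m α s + M)])
    rw [intervalIntegral.integral_add hI intervalIntegrable_const] at h3
    simp only [intervalIntegral.integral_const, sub_zero, smul_eq_mul] at h3
    unfold costT at hn
    have e : Real.exp (-δ*T) = 1 - κ := by rw [hκ]; ring_nf
    rw [e] at h1
    have h4 : (1 - κ) * Vfun S 1 δ (m T) ≤ (1-κ) * v :=
      mul_le_mul_of_nonneg_left h2 (by rw [← e]; positivity)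
    nlinarith
  have h2 := le_ciSup hbdd μ
  nlinarith

lemma lv_V_low (S : MFGSetting d) {M : ℝ} (hM : lvBd S M) {δ T u : ℝ} (hδ : 0 < δ) (hT : 0 < T)
    (hU : ∀ μ, u ≤ Ufun S 1 T μ) (μ : PTd d) :
    u - (u + M * T) * (1 - Real.exp (-(δ*T))) ≤ (1 - Real.exp (-(δ*T))) * Vfun S 1 δ μ := by
  set κ := 1 - Real.exp (-(δ*T)) with hκ
  have hκ0 : 0 < κ := (lv_exp_bds (by positivity)).1
  have hbdd : BddBelow (range (Vfun S 1 δ : PTd d → ℝ)) := ⟨-(M/δ), by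
    rintro _ ⟨μ, rfl⟩; exact (abs_le.1 (lv_V_abs S hM hδ μ)).1⟩
  have hne : Nonempty (PTd d) := ⟨μ⟩
  set v := ⨅ μ, (Vfun S 1 δ : PTd d → ℝ) μ with hv
  have key : u - (u + M * T) * κ + (1 - κ) * v ≤ v := by
    refine le_ciInf fun μ => le_of_forall_pos_le_add fun η hη => ?_
    obtain ⟨m, α, h, hn⟩ := lv_V_near S hδ μ hη
    have h1 := lv_disc_split S hT.le h
    have h2 := (ciInf_le hbdd (m T)).trans (lv_V_le S hM hδ (lv_disc_shift S hT.le h))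
    have hA := lv_disc_restrict S hδ hT.le h
    have hI := hA.2.2.2.2.2
    have hE : IntervalIntegrable (fun s => Real.exp (-δ * s) * runCost S m α s) volume 0 T := lv_exp_int_iff.2 hI
    have h3 := intervalIntegral.integral_mono_on hT.le ((hI.const_mul (1-κ)).sub (intervalIntegrable_const (c := M * κ))) hE (by
      intro s hs
      have a1 : Real.exp (-δ*s) ≤ 1 := Real.exp_le_one_iff.2 (by nlinarith [hs.1])
      have a2 : 1 - κ ≤ Real.exp (-δ*s) := by
        rw [hκ, sub_sub_cancel]
        exact Real.exp_le_exp.2 (by nlinarith [hs.2])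
      have a3 := hM.2.1 m α s
      have := hM.1
      change (1-κ) * runCost S m α s - M * κ ≤ _
      nlinarith [mul_nonneg (sub_nonneg.2 a2) (by linarith : 0 ≤ runCost S m α s + M)])
    rw [intervalIntegral.integral_sub (hI.const_mul (1-κ)) intervalIntegrable_const,
      intervalIntegral.integral_const_mul] at h3
    simp only [intervalIntegral.integral_const, sub_zero, smul_eq_mul] at h3
    have h5 := (hU μ).trans (lv_U_le S hM hT.le hA)
    unfold costT at h5
    have e : Real.exp (-δ*T) = 1 - κ := by rw [hκ]; ring_nf
    have e0 : 0 ≤ 1 - κ := by rw [← e]; positivity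
    rw [e] at h1
    have h4 := mul_le_mul_of_nonneg_left h2 e0
    have h6 := mul_le_mul_of_nonneg_left h5 e0
    nlinarith
  have h2 := ciInf_le hbdd μ
  nlinarith

lemma lv_V_limit (S : MFGSetting d) (lam : ℝ) (hU : IsLimitValueU S 1 lam) : IsLimitValueV S 1 lam := by
  obtain ⟨M, hM⟩ := lv_exBd S
  have hM0 := hM.1
  intro ε hε
  obtain ⟨T₀, hT₀⟩ := hU (ε/2) (by positivity)
  set T := max T₀ 1
  have hT : 0 < T := lt_of_lt_of_le one_pos (le_max_right _ _)
  have hTU := hT₀ T (le_max_left _ _)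
  set B := T * (2 * (|lam| + ε) + M) with hB
  have hB0 : 0 ≤ B := by positivity
  refine ⟨ε / (2 * (B+1)), by positivity, fun δ hδ hδ' μ => ?_⟩
  have hx : 0 < δ * T := by positivity
  have hb : δ * B < ε/2 := by
    rw [le_div_iff₀ (by positivity)] at hδ'
    nlinarith
  obtain ⟨k0, k1, k2⟩ := lv_exp_bds hx
  have u1 := lv_V_up S hM (u := T * (-lam + ε/2)) hδ hT (fun μ => by
    have := (abs_lt.1 (hTU μ)).2
    have : Ufun S 1 T μ / T < -lam + ε/2 := by linarith
    rwa [div_lt_iff₀ hT, mul_comm] at this) μ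
  have u2 := lv_V_low S hM (u := T * (-lam - ε/2)) hδ hT (fun μ => by
    have := (abs_lt.1 (hTU μ)).1
    have : -lam - ε/2 ≤ Ufun S 1 T μ / T := by linarith
    rwa [le_div_iff₀ hT, mul_comm] at this) μ
  set κ := 1 - Real.exp (-(δ*T)) with hκ
  set r := δ * T / κ with hr
  have hrk : r * κ = δ * T := by rw [hr]; field_simp
  have v1 : δ * Vfun S 1 δ μ ≤ r * (-lam + ε/2) + δ * T * M := by
    refine le_of_mul_le_mul_left ?_ k0
    have := mul_le_mul_of_nonneg_left u1 hδ.le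
    have e : κ * (r * (-lam + ε/2) + δ * T * M) = δ * (T * (-lam + ε/2) + M * T * κ) := by
      linear_combination (-lam + ε/2) * hrk
    rw [e]
    linarith
  have v2 : r * (-lam - ε/2) - δ * T * ((-lam - ε/2) + M) ≤ δ * Vfun S 1 δ μ := by
    refine le_of_mul_le_mul_left ?_ k0
    have := mul_le_mul_of_nonneg_left u2 hδ.le
    have e : κ * (r * (-lam - ε/2) - δ * T * ((-lam - ε/2) + M)) =
        δ * (T * (-lam - ε/2) - (T * (-lam - ε/2) + M * T) * κ) := by
      linear_combination (-lam - ε/2) * hrk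
    rw [e]
    linarith
  have l1 := le_abs_self lam
  have l2 := neg_abs_le lam
  have q0 : 0 ≤ r - 1 := by linarith
  have q1 : r - 1 ≤ δ * T := by linarith
  have w1 : (r-1) * (-lam + ε/2) ≤ δ * T * (|lam| + ε) :=
    (mul_le_mul_of_nonneg_left (by linarith : -lam + ε/2 ≤ |lam| + ε) q0).trans
      (mul_le_mul_of_nonneg_right q1 (by positivity))
  have w2 : (r-1) * (lam + ε/2) ≤ δ * T * (|lam| + ε) :=
    (mul_le_mul_of_nonneg_left (by linarith : lam + ε/2 ≤ |lam| + ε) q0).trans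
      (mul_le_mul_of_nonneg_right q1 (by positivity))
  have w3 : δ * T * (-lam - ε/2) ≤ δ * T * (|lam| + ε) :=
    mul_le_mul_of_nonneg_left (by linarith) hx.le
  have w4 : 0 ≤ δ * T * (|lam| + ε) := by positivity
  have hBe : δ * B = 2 * (δ * T * (|lam| + ε)) + δ * T * M := by rw [hB]; ring
  rw [abs_lt]
  constructor <;> nlinarith
end tauber

/-- Theorem 1.8 of the paper.  The limit value `-λ` is uniquely defined:
`δ 𝒱_δ(·) → -λ` uniformly along the full family `δ → 0⁺`, and `𝒰(T,·)/T → -λ`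
uniformly as `T → ∞`. -/
theorem limit_value_unique (d : ℕ) (S : MFGSetting d) (lam : ℝ)
    (hlam : ∃ δseq : ℕ → ℝ, (∀ n : ℕ, 0 < δseq n) ∧
      Filter.Tendsto δseq Filter.atTop (nhds 0) ∧
      ∀ ε > 0, ∃ N : ℕ, ∀ n ≥ N, ∀ μ : PTd d,
        |δseq n * Vfun S 1 (δseq n) μ - (-lam)| < ε) :
    IsLimitValueV S 1 lam ∧ IsLimitValueU S 1 lam := by
  have hU := lv_U_limit S lam hlam
  exact ⟨lv_V_limit S lam hU, hU⟩
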